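/- arXiv:2002.09942 — 2 statements merged into one kernel-verified Lean document; each statement's English description precedes it below -/
import Mathlib

section
/- Let G = (𝒢, Ω, v₀) be a game with Nature with Borel winning condition Ω, and let Ĝ be the associated two-player game without Nature. Then LVal(G) ≤ ℵ₀ if and only if Éloïse has a winning strategy in Ĝ. Moreover, from a winning strategy (resp. positional winning strategy, resp. finite-memory winning strategy) φ̂_E of Éloïse in Ĝ one can define a strategy (resp. positional strategy, resp. finite-memory strategy) φ_E for Éloïse in G with CL(φ_E) ≤ ℵ₀. -/
open Cardinal

/-- The three players: Éloïse, Abélard and Nature. -/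
inductive Player : Type
  | E
  | A
  | N
  deriving DecidableEq

/-- An arena: a directed graph without dead-ends whose vertices are
partitioned among the three players (via the `owner` function). -/
structure Arena (V : Type) where
  Edge : V → V → Prop
  owner : V → Player
  no_dead : ∀ v, ∃ w, Edge v w

/-- The history `[p 0, …, p i]` of a play `p` up to time `i`. -/
def histUpTo {V : Type} (p : ℕ → V) (i : ℕ) : List V :=
  List.ofFn (fun j : Fin (i + 1) => p j.1)

/-- A play from `v0`: an infinite sequence following edges. -/
def IsPlay {V : Type} (A : Arena V) (v0 : V) (p : ℕ → V) : Prop :=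
  p 0 = v0 ∧ ∀ i, A.Edge (p i) (p (i + 1))

/-- The player `P` respects the strategy `φ` along the play `p`. -/
def Respects {V : Type} (A : Arena V) (P : Player) (φ : List V → V) (p : ℕ → V) : Prop :=
  ∀ i, A.owner (p i) = P → p (i + 1) = φ (histUpTo p i)

/-- `φ` is a strategy for player `P`: on every history ending in a vertex of `P`
it prescribes a successor of that vertex. -/
def IsStrategyFor {V : Type} (A : Arena V) (P : Player) (φ : List V → V) : Prop :=
  ∀ (l : List V) (v : V), A.owner v = P → A.Edge v (φ (l ++ [v]))

/-- The set of plays from `v0` in which Éloïse respects `φE` and Abélard respects `φA`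
(Nature is unconstrained). -/
def Outcomes {V : Type} (A : Arena V) (v0 : V) (φE φA : List V → V) : Set (ℕ → V) :=
  {p | IsPlay A v0 p ∧ Respects A Player.E φE p ∧ Respects A Player.A φA p}

/-- `l` is a (finite) prefix of the infinite word `p`. -/
def BPrefix {X : Type} (p : ℕ → X) (l : List X) : Prop :=
  ∀ i : Fin l.length, p i.1 = l.get i
/-- The type of Abélard strategies. -/
def AStrat {V : Type} (A : Arena V) : Type :=
  {φ : List V → V // IsStrategyFor A Player.A φ}

/-- The type of Éloïse strategies. -/
def EStrat {V : Type} (A : Arena V) : Type :=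
  {φ : List V → V // IsStrategyFor A Player.E φ}

/-- The cardinality leaking of an Éloïse strategy: the supremum, over Abélard
strategies, of the cardinality of the set of losing plays. -/
noncomputable def CL {V : Type} (A : Arena V) (v0 : V) (Ω : Set (ℕ → V))
    (φE : List V → V) : Cardinal :=
  ⨆ φA : AStrat A, Cardinal.mk ↥(Outcomes A v0 φE φA.1 \ Ω)

/-- The leaking value of a game: the infimum over Éloïse strategies of the
cardinality leaking. -/
noncomputable def LVal {V : Type} (A : Arena V) (v0 : V) (Ω : Set (ℕ → V)) : Cardinal :=
  ⨅ φE : EStrat A, CL A v0 Ω φE.1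
/-- `Ω ⊆ V^ω` is a Borel winning condition: Borel for the product topology on
`ℕ → V`, `V` being given the discrete topology. -/
def BorelWC {V : Type} (Ω : Set (ℕ → V)) : Prop :=
  letI : TopologicalSpace V := ⊥
  @MeasurableSet (ℕ → V) (borel (ℕ → V)) Ω
/-- A positional strategy only depends on the current vertex. -/
def PositionalF {V α : Type} (φ : List V → α) : Prop :=
  ∃ f : V → α, ∀ (l : List V) (v : V), φ (l ++ [v]) = f v

/-- A finite-memory strategy: implemented by a finite-state machine reading the
visited vertices. -/
def FiniteMemoryF {V α : Type} (φ : List V → α) : Prop :=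
  ∃ (M : Type) (_ : Finite M) (m0 : M) (up : M → V → M) (mov : M → V → α),
    ∀ (l : List V) (v : V), φ (l ++ [v]) = mov ((l ++ [v]).tail.foldl up m0) v
/-- In a game without Nature, an Éloïse strategy is (surely) winning if every play
from `v0` in which she respects it belongs to the winning condition. -/
def WinsE {V : Type} (A : Arena V) (v0 : V) (W : Set (ℕ → V)) (φ : List V → V) : Prop :=
  ∀ p, IsPlay A v0 p → Respects A Player.E φ p → p ∈ W

/-- In a game without Nature, an Abélard strategy is (surely) winning if every play
from `v0` in which he respects it lies outside the winning condition. -/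
def WinsA {V : Type} (A : Arena V) (v0 : V) (W : Set (ℕ → V)) (φ : List V → V) : Prop :=
  ∀ p, IsPlay A v0 p → Respects A Player.A φ p → p ∉ W
/-- The arena of the game `Ĝ` without Nature associated with a game with Nature:
vertices of `V_E` and `V_N` belong to Éloïse, vertices of `V_A` and the gadget
vertices `(v, w)` (for `v ∈ V_N` and `w ∈ E(v)`) belong to Abélard.  From a
Nature vertex `v` Éloïse moves to some `(v, w)` (announcing she wants to avoid
`w`), from which Abélard moves to any successor `w'` of `v`. -/
def hatArena {V : Type} (A : Arena V) : Arena (V ⊕ V × V) where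
  Edge x y :=
    match x, y with
    | Sum.inl u, Sum.inl w => A.Edge u w ∧ A.owner u ≠ Player.N
    | Sum.inl v, Sum.inr vw => v = vw.1 ∧ A.owner v = Player.N ∧ A.Edge v vw.2
    | Sum.inr vw, Sum.inl w' => A.Edge vw.1 w'
    | Sum.inr _, Sum.inr _ => False
  owner x :=
    match x with
    | Sum.inl v => if A.owner v = Player.N then Player.E else A.owner v
    | Sum.inr _ => Player.A
  no_dead := by
    rintro (v | vw)
    · by_cases h : A.owner v = Player.N
      · obtain ⟨w, hw⟩ := A.no_dead v
        exact ⟨Sum.inr (v, w), rfl, h, hw⟩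
      · obtain ⟨w, hw⟩ := A.no_dead v
        exact ⟨Sum.inl w, hw, h⟩
    · obtain ⟨w', hw'⟩ := A.no_dead vw.1
      exact ⟨Sum.inl w', hw'⟩

/-- `q` is the projection of the play `p` of `Ĝ`, obtained by erasing the gadget
vertices. -/
def ProjOf {V : Type} (q : ℕ → V) (p : ℕ → V ⊕ V × V) : Prop :=
  ∃ k : ℕ → ℕ, StrictMono k ∧ (∀ n, p (k n) = Sum.inl (q n)) ∧
    ∀ m v, p m = Sum.inl v → ∃ n, k n = m

/-- Abélard obeys Éloïse at time `m` in the play `p` of `Ĝ`: from a gadget vertex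
`(v, w)` he moves to some `w' ≠ w`. -/
def ObeysAt {V : Type} (p : ℕ → V ⊕ V × V) (m : ℕ) : Prop :=
  ∃ v w w', p m = Sum.inr (v, w) ∧ p (m + 1) = Sum.inl w' ∧ w' ≠ w

/-- The winning condition of `Ĝ`: plays whose projection belongs to `Ω`, together
with the plays in which Abélard obeys Éloïse only finitely often. -/
def hatWC {V : Type} (Ω : Set (ℕ → V)) : Set (ℕ → V ⊕ V × V) :=
  {p | (∃ q, ProjOf q p ∧ q ∈ Ω) ∨ {m | ObeysAt p m}.Finite}

namespace LeakAux
open Set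

def pre {α : Type} (p : ℕ → α) (n : ℕ) : List α := (List.range n).map p

theorem pre_zero {α : Type} (p : ℕ → α) : pre p 0 = [] := rfl

theorem pre_succ {α : Type} (p : ℕ → α) (n : ℕ) : pre p (n+1) = pre p n ++ [p n] := by
  simp [pre, List.range_succ]

theorem pre_len {α : Type} (p : ℕ → α) (n : ℕ) : (pre p n).length = n := by simp [pre]

theorem hist_eq {α : Type} (p : ℕ → α) (n : ℕ) : histUpTo p n = pre p (n+1) := by
  apply List.ext_getElem
  · simp [histUpTo, pre]
  · intro i h1 h2
    simp only [histUpTo, pre, List.getElem_ofFn, List.getElem_map, List.getElem_range]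

theorem pre_prefix {α : Type} (p : ℕ → α) {m n : ℕ} (h : m ≤ n) : pre p m <+: pre p n := by
  induction n, h using Nat.le_induction with
  | base => exact List.prefix_rfl
  | succ n _ ih => rw [pre_succ]; exact ih.trans (List.prefix_append _ _)

theorem eq_pre_of_prefix {α : Type} {p : ℕ → α} {n : ℕ} {l : List α} (h : l <+: pre p n) :
    l = pre p l.length := by
  apply List.IsPrefix.eq_of_length _ (pre_len p _).symm
  apply List.prefix_of_prefix_length_le h (pre_prefix p _) (by simp [pre_len])
  have := h.length_le
  rwa [pre_len] at this

theorem pre_prefix_pre {α : Type} {x z : ℕ → α} {m n : ℕ} (h : pre x m <+: pre z n) :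
    pre x m = pre z m := by
  have := eq_pre_of_prefix h
  rwa [pre_len] at this

theorem pre_eq_apply {α : Type} {x z : ℕ → α} {m : ℕ} (h : pre x m = pre z m) {i : ℕ}
    (hi : i < m) : x i = z i := by
  have h1 : pre x (i+1) = pre z (i+1) := by
    apply pre_prefix_pre (n := m); rw [← h]; exact pre_prefix x hi
  rw [pre_succ, pre_succ] at h1
  simpa using (List.append_inj' h1 rfl).2

theorem limit {α : Type} [Nonempty α] (L : ℕ → List α) (hm : ∀ n, L n <+: L (n+1))
    (hl : ∀ n, n ≤ (L n).length) : ∃ p : ℕ → α, ∀ n, L n = pre p (L n).length := by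
  have a0 : α := Classical.arbitrary α
  have mono : ∀ m n, m ≤ n → L m <+: L n := by
    intro m n h
    induction n, h using Nat.le_induction with
    | base => exact List.prefix_rfl
    | succ n _ ih => exact ih.trans (hm n)
  refine ⟨fun i => (L (i+1)).getD i a0, fun n => ?_⟩
  apply List.ext_getElem
  · simp [pre]
  · intro i h1 h2
    have h3 : i < (L (i+1)).length := hl (i+1)
    simp only [pre, List.getElem_map, List.getElem_range, List.getD_eq_getElem _ _ h3]
    rcases le_total n (i+1) with h | h
    · exact (mono _ _ h).getElem h1
    · exact ((mono _ _ h).getElem h3).symm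

/-- legal histories -/
def Legal {V : Type} (A : Arena V) (φE : List V → V) (h : List V) : Prop :=
  ∀ g v w, g ++ [v, w] <+: h → A.Edge v w ∧ (A.owner v = Player.E → w = φE (g ++ [v]))

theorem Legal.snoc {V : Type} {A : Arena V} {φE : List V → V} {g : List V} {v w : V}
    (h : Legal A φE (g ++ [v])) (he : A.Edge v w) (ho : A.owner v = Player.E → w = φE (g ++ [v])) :
    Legal A φE (g ++ [v, w]) := by
  intro g' v' w' hp
  have : g ++ [v, w] = (g ++ [v]) ++ [w] := by simp
  rw [this, List.prefix_concat_iff] at hp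
  rcases hp with hp | hp
  · have e : g' ++ [v', w'] = (g' ++ [v']) ++ [w'] := by simp
    rw [e] at hp
    obtain ⟨h1, h2⟩ := List.append_inj' hp rfl
    obtain ⟨h3, h4⟩ := List.append_inj' h1 rfl
    simp at h2 h4
    subst h2 h4 h3
    exact ⟨he, ho⟩
  · exact h _ _ _ hp

theorem pre_two {α : Type} (p : ℕ → α) (n : ℕ) :
    pre p (n+2) = pre p n ++ [p n, p (n+1)] := by simp [pre_succ]

theorem legal_pre {V : Type} {A : Arena V} {φE : List V → V} {x : ℕ → V}
    (hx : ∀ i, A.Edge (x i) (x (i+1))) (hE : Respects A Player.E φE x) (n : ℕ) :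
    Legal A φE (pre x n) := by
  intro g v w hp
  have h1 := eq_pre_of_prefix hp
  simp only [List.length_append, List.length_cons, List.length_nil] at h1
  rw [show g.length + (0+1+1) = g.length + 2 from rfl, pre_two] at h1
  obtain ⟨h2, h3⟩ := List.append_inj' h1 rfl
  simp at h3
  obtain ⟨rfl, rfl⟩ := h3
  refine ⟨hx _, fun ho => ?_⟩
  rw [hE _ ho, hist_eq, pre_succ, ← h2]

def Step {V : Type} (A : Arena V) (φE : List V → V) (Safe S : List V → List ℕ → Prop)
    (h : List V) (σ : List ℕ) : Prop :=
  ¬ Safe h σ ∨ ∀ g v, h <+: g ++ [v] → Legal A φE (g ++ [v]) → A.owner v = Player.N →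
    ∃ w, A.Edge v w ∧ ∀ w', A.Edge v w' → w' ≠ w → ∀ n, S (g ++ [v, w']) (σ ++ [n])

theorem Step.mono {V : Type} {A : Arena V} {φE : List V → V} {Safe S T : List V → List ℕ → Prop}
    (hST : ∀ h σ, S h σ → T h σ) {h : List V} {σ : List ℕ} (H : Step A φE Safe S h σ) :
    Step A φE Safe T h σ := by
  rcases H with H | H
  · exact Or.inl H
  · right
    intro g v h1 h2 h3
    obtain ⟨w, hw, hw'⟩ := H g v h1 h2 h3
    exact ⟨w, hw, fun w' a b n => hST _ _ (hw' w' a b n)⟩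

def Lo {V : Type} (A : Arena V) (φE : List V → V) (Safe : List V → List ℕ → Prop)
    (α : Ordinal.{0}) (h : List V) (σ : List ℕ) : Prop :=
  Step A φE Safe (fun h σ => ∃ β : {β : Ordinal.{0} // β < α}, Lo A φE Safe β.1 h σ) h σ
termination_by α
decreasing_by exact β.2

theorem Lo_iff {V : Type} (A : Arena V) (φE : List V → V) (Safe : List V → List ℕ → Prop)
    (α : Ordinal.{0}) (h : List V) (σ : List ℕ) : Lo A φE Safe α h σ ↔
  Step A φE Safe (fun h σ => ∃ β < α, Lo A φE Safe β h σ) h σ := by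
  rw [Lo]
  constructor <;> refine fun H => H.mono ?_
  · rintro h σ ⟨β, hβ⟩; exact ⟨β.1, β.2, hβ⟩
  · rintro h σ ⟨β, h1, hβ⟩; exact ⟨⟨β, h1⟩, hβ⟩

theorem Lo_closed {V : Type} (A : Arena V) (φE : List V → V) (Safe : List V → List ℕ → Prop)
    (h : List V) (σ : List ℕ)
    (H : Step A φE Safe (fun h σ => ∃ α, Lo A φE Safe α h σ) h σ) :
    ∃ α, Lo A φE Safe α h σ := by
  classical
  let r : List V × List ℕ → Ordinal.{0} := fun x =>
    if hx : ∃ α, Lo A φE Safe α x.1 x.2 then hx.choose else 0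
  obtain ⟨b, hb⟩ : BddAbove (Set.range r) := Ordinal.bddAbove_of_small
  refine ⟨Order.succ b, ?_⟩
  rw [Lo_iff]
  refine H.mono ?_
  intro h σ hx
  refine ⟨r (h, σ), ?_, ?_⟩
  · exact Order.lt_succ_of_le (hb ⟨_, rfl⟩)
  · simp only [r]
    rw [dif_pos hx]
    exact hx.choose_spec

/-- the combined predictor -/
theorem combine {V : Type} (N : V → Prop) (P : ℕ → List V → V → V) (T : ℕ → ℕ) :
    ∃ C : List V → V → V, (∀ g v, ∃ k, C g v = P k g v) ∧
      ∀ x : ℕ → V, (∃ k, ∀ i ≥ T k, N (x i) → x (i+1) = P k (pre x i) (x i)) →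
        ∃ M, ∀ i ≥ M, N (x i) → x (i+1) = C (pre x i) (x i) := by
  classical
  let R : ℕ → List V → Prop := fun k H =>
    ∃ g v w, g ++ [v, w] <+: H ∧ T k ≤ g.length ∧ N v ∧ w ≠ P k g v
  refine ⟨fun g v => if h : ∃ k, ¬ R k (g ++ [v]) then P (Nat.find h) g v else P 0 g v, ?_, ?_⟩
  · intro g v
    by_cases h : ∃ k, ¬ R k (g ++ [v])
    · exact ⟨Nat.find h, by simp only [dif_pos h]⟩
    · exact ⟨0, by simp only [dif_neg h]⟩
  · intro x hx
    have hx' : ∃ k, ∀ n, ¬ R k (pre x n) := by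
      obtain ⟨k, hk⟩ := hx
      refine ⟨k, ?_⟩
      rintro n ⟨g, v, w, hp, hT, hN, hw⟩
      have h1 := eq_pre_of_prefix hp
      simp only [List.length_append, List.length_cons, List.length_nil] at h1
      rw [show g.length + (0+1+1) = g.length + 2 from rfl, pre_two] at h1
      obtain ⟨h2, h3⟩ := List.append_inj' h1 rfl
      simp at h3
      obtain ⟨rfl, rfl⟩ := h3
      apply hw
      rw [hk _ hT hN, ← h2]
    let K := Nat.find hx'
    have hK : ∀ n, ¬ R K (pre x n) := Nat.find_spec hx'
    have hlt : ∀ k < K, ∃ n, R k (pre x n) := by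
      intro k hk
      have := Nat.find_min hx' hk
      push Not at this
      exact this
    choose! n hn using hlt
    refine ⟨max (T K) ((Finset.range K).sup n), ?_⟩
    intro i hi hNi
    have hex : ∃ k, ¬ R k (pre x i ++ [x i]) := ⟨K, by rw [← pre_succ]; exact hK _⟩
    have hfind : Nat.find hex = K := by
      rw [Nat.find_eq_iff]
      refine ⟨by rw [← pre_succ]; exact hK _, ?_⟩
      intro k hk
      rw [not_not, ← pre_succ]
      obtain ⟨g, v, w, hp, h2⟩ := hn k hk
      refine ⟨g, v, w, hp.trans (pre_prefix x ?_), h2⟩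
      have : n k ≤ (Finset.range K).sup n := Finset.le_sup (f := n) (Finset.mem_range.2 hk)
      have := le_max_right (T K) ((Finset.range K).sup n)
      omega
    beta_reduce
    rw [dif_pos hex, hfind]
    by_contra hne
    apply hK (i+2)
    refine ⟨pre x i, x i, x (i+1), by rw [pre_two], ?_, hNi, hne⟩
    rw [pre_len]
    exact (le_max_left _ _).trans hi

theorem exists_pred {V : Type} [Countable V] (A : Arena V) (v0 : V) (φE : List V → V)
    (Safe : List V → List ℕ → Prop) (hroot : ∃ α, Lo A φE Safe α [v0] []) :
    ∃ C : List V → V → V, (∀ g v, A.Edge v (C g v)) ∧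
      ∀ x : ℕ → V, IsPlay A v0 x → Respects A Player.E φE x →
        (∃ y : ℕ → ℕ, ∀ m n, Safe (pre x m) (pre y n)) →
        ∃ M, ∀ i ≥ M, A.owner (x i) = Player.N → x (i+1) = C (pre x i) (x i) := by
  classical
  choose s hs using A.no_dead
  let Good : List V × List ℕ → List V → V → V → Prop := fun a g v w =>
    A.Edge v w ∧ ∀ w', A.Edge v w' → w' ≠ w → ∀ n,
      ∃ β < sInf {α | Lo A φE Safe α a.1 a.2}, Lo A φE Safe β (g ++ [v, w']) (a.2 ++ [n])
  let D : List V × List ℕ → List V → V → V := fun a g v =>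
    if h : ∃ w, Good a g v w then h.choose else s v
  have hD : ∀ a g v, A.Edge v (D a g v) := by
    intro a g v
    simp only [D]
    split_ifs with h
    · exact h.choose_spec.1
    · exact hs v
  have hD2 : ∀ a g v, (∃ w, Good a g v w) → Good a g v (D a g v) := by
    intro a g v h
    simp only [D]
    rw [dif_pos h]
    exact h.choose_spec
  obtain ⟨e, he⟩ := exists_surjective_nat (List V × List ℕ)
  obtain ⟨C, hC1, hC2⟩ := combine (fun v => A.owner v = Player.N) (fun k => D (e k))
    (fun k => (e k).1.length)
  refine ⟨C, ?_, ?_⟩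
  · intro g v
    obtain ⟨k, hk⟩ := hC1 g v
    rw [hk]; exact hD _ _ _
  · rintro x ⟨hx0, hxe⟩ hxE ⟨y, hy⟩
    apply hC2
    suffices H : ∀ α m n, Lo A φE Safe α (pre x m) (pre y n) →
        ∃ a : List V × List ℕ, ∀ i ≥ a.1.length, A.owner (x i) = Player.N →
          x (i+1) = D a (pre x i) (x i) by
      obtain ⟨α, hα⟩ := hroot
      obtain ⟨a, ha⟩ := H α 1 0 (by simpa [pre, hx0] using hα)
      obtain ⟨k, rfl⟩ := he a
      exact ⟨k, ha⟩
    intro α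
    induction α using WellFoundedLT.induction with
    | ind α ih =>
      intro m n hα
      by_contra hcon
      push Not at hcon
      obtain ⟨i, hi, hN, hne⟩ := hcon (pre x m, pre y n)
      simp only [pre_len] at hi
      have hmem : sInf {α | Lo A φE Safe α (pre x m) (pre y n)} ∈
        {α | Lo A φE Safe α (pre x m) (pre y n)} := csInf_mem ⟨α, hα⟩
      have hle : sInf {α | Lo A φE Safe α (pre x m) (pre y n)} ≤ α := csInf_le' hα
      have h1 := hmem
      rw [Set.mem_ofPred_eq, Lo_iff] at h1
      rcases h1 with h1 | h1
      · exact h1 (hy m n)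
      · have h2 := hD2 (pre x m, pre y n) (pre x i) (x i)
          (h1 (pre x i) (x i) (by rw [← pre_succ]; exact pre_prefix x (by omega))
            (by rw [← pre_succ]; exact legal_pre hxe hxE _) hN)
        obtain ⟨β, hβ, hβ2⟩ := h2.2 (x (i+1)) (hxe i) hne (y n)
        obtain ⟨a, ha⟩ := ih β (hβ.trans_le hle) (i+2) (n+1) (by
          rw [pre_two, pre_succ]; exact hβ2)
        obtain ⟨j, hj1, hj2, hj3⟩ := hcon a
        exact hj3 (ha j hj1 hj2)


theorem Legal.of_prefix {V : Type} {A : Arena V} {φE : List V → V} {g h : List V}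
    (H : Legal A φE h) (hp : g <+: h) : Legal A φE g :=
  fun g' v w h' => H g' v w (h'.trans hp)

theorem cantor_part {V : Type} (A : Arena V) (v0 : V) (φE : List V → V)
    (Safe : List V → List ℕ → Prop) (hroot : ¬ ∃ α, Lo A φE Safe α [v0] []) :
    ∃ x : (ℕ → Bool) → ℕ → V,
      (∀ β, IsPlay A v0 (x β) ∧ Respects A Player.E φE (x β) ∧
        ∃ y : ℕ → ℕ, ∀ n, ∃ m ≥ n, Safe (pre (x β) m) (pre y n)) ∧
      ∀ β γ, β ≠ γ → ∃ L, pre (x β) (L+1) = pre (x γ) (L+1) ∧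
        A.owner (x β L) = Player.N ∧ x β (L+1) ≠ x γ (L+1) := by
  classical
  have split : ∀ a : {a : List V × List ℕ // ¬ ∃ α, Lo A φE Safe α a.1 a.2},
      ∃ (g : List V) (v : V) (W : Bool → V) (n : Bool → ℕ), a.1.1 <+: g ++ [v] ∧
        Legal A φE (g ++ [v]) ∧ A.owner v = Player.N ∧ (∀ b, A.Edge v (W b)) ∧
        W true ≠ W false ∧ ∀ b, ¬ ∃ α, Lo A φE Safe α (g ++ [v, W b]) (a.1.2 ++ [n b]) := by
    rintro ⟨⟨h, σ⟩, ha⟩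
    have h1 : ¬ Step A φE Safe (fun h σ => ∃ α, Lo A φE Safe α h σ) h σ :=
      fun H => ha (Lo_closed A φE Safe h σ H)
    unfold Step at h1
    push Not at h1
    obtain ⟨-, g, v, hp, hl, ho, hw⟩ := h1
    obtain ⟨w, hwe⟩ := A.no_dead v
    obtain ⟨w1, he1, -, n1, hb1⟩ := hw w hwe
    obtain ⟨w2, he2, hne, n2, hb2⟩ := hw w1 he1
    refine ⟨g, v, fun b => bif b then w2 else w1, fun b => bif b then n2 else n1, hp, hl, ho,
      ?_, by simpa using hne, ?_⟩
    · rintro (_ | _) <;> simpa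
    · rintro (_ | _) <;> simpa
  have safe : ∀ a : {a : List V × List ℕ // ¬ ∃ α, Lo A φE Safe α a.1 a.2},
      Safe a.1.1 a.1.2 := by
    rintro ⟨⟨h, σ⟩, ha⟩
    by_contra hs
    exact ha (Lo_closed A φE Safe h σ (Or.inl hs))
  choose G u W n hp hl ho he hne hbad using split
  let root : {a : List V × List ℕ // ¬ ∃ α, Lo A φE Safe α a.1 a.2} := ⟨([v0], []), hroot⟩
  let next : {a : List V × List ℕ // ¬ ∃ α, Lo A φE Safe α a.1 a.2} → Bool →
      {a : List V × List ℕ // ¬ ∃ α, Lo A φE Safe α a.1 a.2} :=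
    fun a b => ⟨(G a ++ [u a, W a b], a.1.2 ++ [n a b]), hbad a b⟩
  let st : (ℕ → Bool) → ℕ → {a : List V × List ℕ // ¬ ∃ α, Lo A φE Safe α a.1 a.2} :=
    fun β m => Nat.rec root (fun m a => next a (β m)) m
  have st0 : ∀ β, st β 0 = root := fun β => rfl
  have sts : ∀ β m, st β (m+1) = next (st β m) (β m) := fun β m => rfl
  have hm1 : ∀ β m, (st β m).1.1 <+: (st β (m+1)).1.1 := by
    intro β m
    rw [sts]
    refine (hp _).trans ?_
    exact ⟨[W (st β m) (β m)], by simp [next]⟩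
  have hm1' : ∀ β m, (st β m).1.1.length + 1 ≤ (st β (m+1)).1.1.length := by
    intro β m
    rw [sts]
    have := (hp (st β m)).length_le
    simp [next] at this ⊢
    omega
  have hm2 : ∀ β m, (st β m).1.2 <+: (st β (m+1)).1.2 := by
    intro β m
    rw [sts]
    exact List.prefix_append _ _
  have hl1 : ∀ β m, m + 1 ≤ (st β m).1.1.length := by
    intro β m
    induction m with
    | zero => simp [st0, root]
    | succ m ih => have := hm1' β m; omega
  have hl2 : ∀ β m, (st β m).1.2.length = m := by
    intro β m
    induction m with
    | zero => simp [st0, root]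
    | succ m ih => rw [sts]; simp [next, ih]
  have : Nonempty V := ⟨v0⟩
  have X := fun β => limit (fun m => (st β m).1.1) (hm1 β) (fun m => by have := hl1 β m; omega)
  have Y := fun β => limit (fun m => (st β m).1.2) (hm2 β) (fun m => (hl2 β m).ge)
  choose x hx using X
  choose y hy using Y
  have hleg : ∀ β m, Legal A φE (pre (x β) m) := by
    intro β m
    have h1 : Legal A φE (st β (m+1)).1.1 := by
      rw [sts]
      exact (hl _).snoc (he _ _) (fun h => by rw [ho] at h; cases h)
    refine h1.of_prefix ?_
    rw [hx β (m+1)]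
    apply pre_prefix
    have := hl1 β (m+1)
    omega
  refine ⟨x, fun β => ⟨⟨?_, ?_⟩, ?_, y β, ?_⟩, ?_⟩
  · have := hx β 0
    simp only [st0, root, List.length_singleton] at this
    simpa [pre] using this.symm
  · intro i
    exact (hleg β (i+2) (pre (x β) i) _ _ (by rw [pre_two])).1
  · intro i hi
    rw [hist_eq, pre_succ]
    exact (hleg β (i+2) (pre (x β) i) _ _ (by rw [pre_two])).2 hi
  · intro m
    refine ⟨(st β m).1.1.length, by have := hl1 β m; omega, ?_⟩
    have h := safe (st β m)
    have h2 := hy β m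
    have h1 := hx β m
    simp only [hl2] at h2
    rw [← h2, ← h1]
    exact h
  · intro β γ hbc
    have hex : ∃ m, β m ≠ γ m := by
      by_contra hcon
      push Not at hcon
      exact hbc (funext hcon)
    have hmin : ∀ m < Nat.find hex, β m = γ m := fun m hm => by
      simpa using Nat.find_min hex hm
    have hst : ∀ m ≤ Nat.find hex, st β m = st γ m := by
      intro m
      induction m with
      | zero => intro _; rfl
      | succ m ih =>
        intro hm
        rw [sts, sts, ih (by omega), hmin m (by omega)]
    have hd := Nat.find_spec hex
    generalize Nat.find hex = k at *
    have key : ∀ δ, pre (x δ) (G (st δ k)).length = G (st δ k) ∧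
        x δ (G (st δ k)).length = u (st δ k) ∧
        x δ ((G (st δ k)).length + 1) = W (st δ k) (δ k) := by
      intro δ
      have h1 := hx δ (k+1)
      simp only [sts, next] at h1
      simp only [List.length_append, List.length_cons, List.length_nil] at h1
      rw [show (G (st δ k)).length + (0+1+1) = (G (st δ k)).length + 2 from rfl, pre_two] at h1
      obtain ⟨h2, h3⟩ := List.append_inj' h1 rfl
      simp at h3
      exact ⟨h2.symm, h3.1.symm, h3.2.symm⟩
    obtain ⟨b1, b2, b3⟩ := key β
    obtain ⟨c1, c2, c3⟩ := key γ
    rw [← hst k le_rfl] at c1 c2 c3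
    refine ⟨(G (st β k)).length, ?_, ?_, ?_⟩
    · rw [pre_succ, pre_succ, b1, b2, c1, c2]
    · rw [b2, ho]
    · rw [b3, c3]
      have := hne (st β k)
      revert hd
      generalize β k = b
      generalize γ k = c
      intro hd
      cases b <;> cases c
      · exact absurd rfl hd
      · exact this.symm
      · exact this
      · exact absurd rfl hd

theorem uncountable_part {V : Type} (A : Arena V) (v0 : V) (φE : List V → V)
    (x : (ℕ → Bool) → ℕ → V) (X : Set (ℕ → V))
    (hx : ∀ β, IsPlay A v0 (x β) ∧ Respects A Player.E φE (x β) ∧ x β ∉ X)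
    (hd : ∀ β γ, β ≠ γ → ∃ L, pre (x β) (L+1) = pre (x γ) (L+1) ∧
        A.owner (x β L) = Player.N ∧ x β (L+1) ≠ x γ (L+1)) :
    ∃ φA, IsStrategyFor A Player.A φA ∧
      ¬ Cardinal.mk ↥(Outcomes A v0 φE φA \ X) ≤ Cardinal.aleph0 := by
  classical
  choose s hs using A.no_dead
  let φA : List V → V := fun H =>
    if h : ∃ a : (ℕ → Bool) × ℕ, H = pre (x a.1) (a.2+1) ∧ A.owner (x a.1 a.2) = Player.A then
      x h.choose.1 (h.choose.2 + 1) else s (H.getLastD v0)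
  have hA : ∀ β, Respects A Player.A φA (x β) := by
    intro β i hi
    rw [hist_eq]
    have hex : ∃ a : (ℕ → Bool) × ℕ, pre (x β) (i+1) = pre (x a.1) (a.2+1) ∧
      A.owner (x a.1 a.2) = Player.A := ⟨(β, i), rfl, hi⟩
    simp only [φA]
    rw [dif_pos hex]
    obtain ⟨h1, h2⟩ := hex.choose_spec
    generalize hex.choose = a at *
    obtain ⟨γ, j⟩ := a
    simp only at *
    have hij : i = j := by
      have := congrArg List.length h1
      simp only [pre_len] at this
      omega
    subst hij
    by_cases hbc : β = γ
    · rw [hbc]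
    · obtain ⟨L, hL1, hL2, hL3⟩ := hd β γ hbc
      rcases lt_trichotomy i L with h | h | h
      · exact pre_eq_apply hL1 (by omega)
      · subst h; rw [hi] at hL2; cases hL2
      · exact absurd (pre_eq_apply h1 (by omega)) hL3
  refine ⟨φA, ?_, ?_⟩
  · intro l v hv
    simp only [φA]
    split_ifs with h
    · obtain ⟨h1, h2⟩ := h.choose_spec
      rw [pre_succ] at h1
      have := (List.append_inj' h1 rfl).2
      simp only [List.cons.injEq, and_true] at this
      conv_lhs => rw [this]
      exact (hx _).1.2 _
    · simpa using hs v
  · intro hle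
    have hinj : Function.Injective (fun β => (⟨x β, ⟨(hx β).1, (hx β).2.1, hA β⟩, (hx β).2.2⟩ :
        ↥(Outcomes A v0 φE φA \ X))) := by
      intro β γ h
      by_contra hne
      obtain ⟨L, _, _, h3⟩ := hd β γ hne
      apply h3
      have : x β = x γ := congrArg Subtype.val h
      rw [this]
    have h1 := (Cardinal.mk_le_of_injective hinj).trans hle
    have h2 : Cardinal.mk (ℕ → Bool) = 2 ^ Cardinal.aleph0 := by simp
    rw [h2] at h1
    exact absurd (Cardinal.cantor Cardinal.aleph0) (not_lt.2 h1)

/-- Éloïse predicts -/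
theorem exists_pred_borel {V : Type} [Countable V] (A : Arena V) (v0 : V) (φE : List V → V)
    (Ω : Set (ℕ → V)) (hΩ : BorelWC Ω)
    (hc : ∀ φA, IsStrategyFor A Player.A φA →
      Cardinal.mk ↥(Outcomes A v0 φE φA \ Ω) ≤ Cardinal.aleph0) :
    ∃ C : List V → V → V, (∀ g v, A.Edge v (C g v)) ∧
      ∀ x : ℕ → V, IsPlay A v0 x → Respects A Player.E φE x → x ∉ Ω →
        ∃ M, ∀ i ≥ M, A.owner (x i) = Player.N → x (i+1) = C (pre x i) (x i) := by
  classical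
  let _ : TopologicalSpace V := ⊥
  have : DiscreteTopology V := ⟨rfl⟩
  let _ : MeasurableSpace (ℕ → V) := borel (ℕ → V)
  have : BorelSpace (ℕ → V) := ⟨rfl⟩
  have : PolishSpace V := inferInstance
  have hm : MeasurableSet Ω := hΩ
  have han : MeasureTheory.AnalyticSet (Ωᶜ) := hm.compl.analyticSet
  rw [MeasureTheory.AnalyticSet] at han
  rcases han with h0 | ⟨f, hf, hr⟩
  · choose s hs using A.no_dead
    refine ⟨fun _ v => s v, fun _ v => hs v, fun x _ _ hx => ?_⟩
    have : x ∈ Ωᶜ := hx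
    rw [h0] at this
    exact absurd this (Set.notMem_empty x)
  · let Safe : List V → List ℕ → Prop := fun h σ =>
      ∃ y, pre y σ.length = σ ∧ pre (f y) h.length = h
    by_cases hroot : ∃ α, Lo A φE Safe α [v0] []
    · obtain ⟨C, h1, h2⟩ := exists_pred A v0 φE Safe hroot
      refine ⟨C, h1, fun x hx hxE hxO => h2 x hx hxE ?_⟩
      have : x ∈ Ωᶜ := hxO
      rw [← hr] at this
      obtain ⟨y, rfl⟩ := this
      exact ⟨y, fun m n => ⟨y, by rw [pre_len], by rw [pre_len]⟩⟩
    · exfalso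
      obtain ⟨x, h1, h2⟩ := cantor_part A v0 φE Safe hroot
      obtain ⟨φA, h3, h4⟩ := uncountable_part A v0 φE x Ω (fun β => by
        obtain ⟨a1, a2, y, hy⟩ := h1 β
        refine ⟨a1, a2, ?_⟩
        choose m hmn z hz1 hz2 using hy
        simp only [pre_len] at hz1 hz2
        have hz : Filter.Tendsto z Filter.atTop (nhds y) := by
          rw [tendsto_pi_nhds]
          intro i
          apply tendsto_nhds_of_eventually_eq
          filter_upwards [Filter.eventually_gt_atTop i] with n hn
          exact pre_eq_apply (hz1 n) hn
        have hz' := (hf.tendsto y).comp hz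
        have hz2 : Filter.Tendsto (f ∘ z) Filter.atTop (nhds (x β)) := by
          rw [tendsto_pi_nhds]
          intro i
          apply tendsto_nhds_of_eventually_eq
          filter_upwards [Filter.eventually_gt_atTop i] with n hn
          exact pre_eq_apply (hz2 n) (hn.trans_le (hmn n))
        have : x β ∈ Ωᶜ := by
          rw [← hr]
          exact ⟨y, tendsto_nhds_unique hz' hz2⟩
        exact this) h2
      exact h4 (hc φA h3)

/-- `p` is a play of the hat game with projection `q` along `k`. -/
def Corr {V : Type} (A : Arena V) (p : ℕ → V ⊕ V × V) (k : ℕ → ℕ) (q : ℕ → V) : Prop :=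
  k 0 = 0 ∧ ∀ n, p (k n) = Sum.inl (q n) ∧
    ((A.owner (q n) ≠ Player.N ∧ k (n+1) = k n + 1) ∨
     (A.owner (q n) = Player.N ∧ k (n+1) = k n + 2 ∧ ∃ w, p (k n + 1) = Sum.inr (q n, w)))

theorem Corr.strictMono {V : Type} {A : Arena V} {p : ℕ → V ⊕ V × V} {k : ℕ → ℕ} {q : ℕ → V}
    (h : Corr A p k q) : StrictMono k := by
  apply strictMono_nat_of_lt_succ
  intro n
  rcases (h.2 n).2 with h | h <;> omega

theorem Corr.cover {V : Type} {A : Arena V} {p : ℕ → V ⊕ V × V} {k : ℕ → ℕ} {q : ℕ → V}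
    (h : Corr A p k q) (m : ℕ) : ∃ n, k n = m ∨ (k n + 1 = m ∧ A.owner (q n) = Player.N ∧
      k (n+1) = k n + 2 ∧ ∃ w, p (k n + 1) = Sum.inr (q n, w)) := by
  induction m with
  | zero => exact ⟨0, Or.inl h.1⟩
  | succ m ih =>
    obtain ⟨n, hn | hn⟩ := ih
    · rcases (h.2 n).2 with h1 | h1
      · exact ⟨n+1, Or.inl (by omega)⟩
      · exact ⟨n, Or.inr ⟨by omega, h1.1, h1.2.1, h1.2.2⟩⟩
    · exact ⟨n+1, Or.inl (by omega)⟩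

theorem Corr.proj {V : Type} {A : Arena V} {p : ℕ → V ⊕ V × V} {k : ℕ → ℕ} {q : ℕ → V}
    (h : Corr A p k q) : ProjOf q p := by
  refine ⟨k, h.strictMono, fun n => (h.2 n).1, fun m v hm => ?_⟩
  obtain ⟨n, hn | ⟨hn, -, -, w, hw⟩⟩ := h.cover m
  · exact ⟨n, hn⟩
  · rw [hn, hm] at hw; cases hw

theorem proj_unique {V : Type} {p : ℕ → V ⊕ V × V} {q q' : ℕ → V}
    (h : ProjOf q p) (h' : ProjOf q' p) : q = q' := by
  obtain ⟨k, k1, k2, k3⟩ := h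
  obtain ⟨k', k1', k2', k3'⟩ := h'
  have : k = k' := by
    rw [← StrictMono.range_inj k1 k1']
    ext m
    constructor
    · rintro ⟨n, rfl⟩; exact k3' _ _ (k2 n)
    · rintro ⟨n, rfl⟩; exact k3 _ _ (k2' n)
  subst this
  funext n
  have := (k2 n).symm.trans (k2' n)
  simpa using this

theorem Corr.fm {V : Type} {A : Arena V} {p : ℕ → V ⊕ V × V} {k : ℕ → ℕ} {q : ℕ → V}
    (h : Corr A p k q) (n : ℕ) : (pre p (k n)).filterMap Sum.getLeft? = pre q n := by
  induction n with
  | zero => rw [h.1]; rfl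
  | succ n ih =>
    obtain ⟨h1, h2 | ⟨h2, h3, w, h4⟩⟩ := h.2 n
    · rw [h2.2, pre_succ, pre_succ, List.filterMap_append, ih, h1]; simp
    · rw [h3, pre_two, pre_succ, List.filterMap_append, ih, h1, h4]; simp

theorem hat_corr {V : Type} {A : Arena V} {v0 : V} {p : ℕ → V ⊕ V × V}
    (hp : IsPlay (hatArena A) (Sum.inl v0) p) : ∃ k q, Corr A p k q := by
  classical
  obtain ⟨hp0, hpe⟩ := hp
  let k : ℕ → ℕ := fun n => Nat.rec 0 (fun _ a => if (p (a+1)).isLeft then a + 1 else a + 2) n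
  have ks : ∀ n, k (n+1) = if (p (k n+1)).isLeft then k n + 1 else k n + 2 := fun n => rfl
  have hl : ∀ n, ∃ v, p (k n) = Sum.inl v := by
    intro n
    induction n with
    | zero => exact ⟨v0, hp0⟩
    | succ n ih =>
      rw [ks]
      rcases h : p (k n + 1) with v | w
      · simp [h]
      · simp only [Sum.isLeft_inr, Bool.false_eq_true, if_false]
        have h1 := hpe (k n + 1)
        rw [h] at h1
        rcases h' : p (k n + 2) with v | w'
        · simp
        · rw [show k n + 1 + 1 = k n + 2 from rfl, h'] at h1
          exact h1.elim
  choose q hq using hl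
  refine ⟨k, q, rfl, fun n => ⟨hq n, ?_⟩⟩
  have h1 := hpe (k n)
  rw [hq n] at h1
  rcases h : p (k n + 1) with v | ⟨a, b⟩
  · rw [h] at h1
    left
    exact ⟨h1.2, by rw [ks, h]; rfl⟩
  · rw [h] at h1
    right
    obtain ⟨h2, h3, -⟩ := h1
    simp only at h2
    exact ⟨h3, by rw [ks, h]; rfl, b, by rw [h2]⟩

theorem hat_wins {V : Type} (A : Arena V) (v0 : V) (Ω : Set (ℕ → V)) (φE : List V → V)
    (hφE : IsStrategyFor A Player.E φE)
    (C : List V → V → V) (hC : ∀ g v, A.Edge v (C g v))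
    (hC2 : ∀ x : ℕ → V, IsPlay A v0 x → Respects A Player.E φE x → x ∉ Ω →
        ∃ M, ∀ i ≥ M, A.owner (x i) = Player.N → x (i+1) = C (pre x i) (x i)) :
    ∃ φh, IsStrategyFor (hatArena A) Player.E φh ∧
        WinsE (hatArena A) (Sum.inl v0) (hatWC Ω) φh := by
  classical
  let φh : List (V ⊕ V × V) → V ⊕ V × V := fun l =>
    match l.getLast? with
    | some (Sum.inl v) => if A.owner v = Player.N then
        Sum.inr (v, C (l.dropLast.filterMap Sum.getLeft?) v)
        else Sum.inl (φE (l.dropLast.filterMap Sum.getLeft? ++ [v]))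
    | _ => Sum.inl v0
  have φh_eq : ∀ l v, φh (l ++ [Sum.inl v]) = if A.owner v = Player.N then
        Sum.inr (v, C (l.filterMap Sum.getLeft?) v)
        else Sum.inl (φE (l.filterMap Sum.getLeft? ++ [v])) := by
    intro l v
    simp [φh]
  refine ⟨φh, ?_, ?_⟩
  · rintro l (v | w) hv
    · rw [φh_eq]
      by_cases h : A.owner v = Player.N
      · rw [if_pos h]
        exact ⟨rfl, h, hC _ _⟩
      · rw [if_neg h]
        have hv' : A.owner v = Player.E := by simpa [hatArena, h] using hv
        exact ⟨hφE _ _ hv', h⟩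
    · simp [hatArena] at hv
  · intro p hp hpE
    obtain ⟨k, q, hk⟩ := hat_corr hp
    by_cases hqΩ : q ∈ Ω
    · exact Or.inl ⟨q, hk.proj, hqΩ⟩
    right
    have hmove : ∀ n, (A.owner (q n) = Player.N ∨ A.owner (q n) = Player.E) →
        p (k n + 1) = if A.owner (q n) = Player.N then
        Sum.inr (q n, C (pre q n) (q n)) else Sum.inl (φE (pre q (n+1))) := by
      intro n hn
      have h1 := hpE (k n) (by
        rw [(hk.2 n).1]
        rcases hn with h | h <;> simp [hatArena, h])
      rw [hist_eq, pre_succ, (hk.2 n).1, φh_eq, hk.fm, ← pre_succ] at h1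
      exact h1
    have hplay : IsPlay A v0 q := by
      constructor
      · have := (hk.2 0).1
        rw [hk.1, hp.1] at this
        simpa using this.symm
      · intro n
        obtain ⟨h1, h2 | ⟨h2, h3, w, h4⟩⟩ := hk.2 n
        · have h5 := hp.2 (k n)
          have h6 := (hk.2 (n+1)).1
          rw [h2.2] at h6
          rw [h1, h6] at h5
          exact h5.1
        · have h5 := hp.2 (k n + 1)
          have h6 := (hk.2 (n+1)).1
          rw [h3] at h6
          rw [show k n + 1 + 1 = k n + 2 from rfl, h4, h6] at h5
          exact h5
    have hrE : Respects A Player.E φE q := by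
      intro n hn
      have h1 := hmove n (Or.inr hn)
      have hnN : A.owner (q n) ≠ Player.N := by rw [hn]; simp
      rw [if_neg hnN] at h1
      obtain ⟨-, h2 | h2⟩ := hk.2 n
      · have h6 := (hk.2 (n+1)).1
        rw [h2.2, h1] at h6
        rw [hist_eq]
        simpa using h6.symm
      · exact absurd h2.1 hnN
    obtain ⟨M, hM⟩ := hC2 q hplay hrE hqΩ
    refine (Set.finite_Iio (k M + 1)).subset ?_
    rintro m ⟨a, b, c, h1, h2, h3⟩
    obtain ⟨n, hn | ⟨hn, hN, hk2, w, hw⟩⟩ := hk.cover m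
    · rw [← hn, (hk.2 n).1] at h1; cases h1
    · have h4 := hmove n (Or.inl hN)
      rw [if_pos hN, hn, h1] at h4
      have h6 := (hk.2 (n+1)).1
      rw [hk2, show k n + 2 = m + 1 by omega, h2] at h6
      simp only [Sum.inr.injEq, Prod.mk.injEq, Sum.inl.injEq] at h4 h6
      by_contra hcon
      simp only [Set.mem_Iio, not_lt] at hcon
      have hMn : M ≤ n := by
        by_contra hlt
        have := hk.strictMono (show n < M by omega)
        omega
      have := hM n hMn hN
      rw [← h6, ← h4.2] at this
      exact h3 this

open Classical in
noncomputable def ext {V : Type} (A : Arena V) (φh : List (V ⊕ V × V) → V ⊕ V × V)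
    (l : List (V ⊕ V × V)) (v : V) : List (V ⊕ V × V) :=
  if A.owner v = Player.N then l ++ [Sum.inl v, φh (l ++ [Sum.inl v])] else l ++ [Sum.inl v]

noncomputable def EL {V : Type} (A : Arena V) (v0 : V) (φh : List (V ⊕ V × V) → V ⊕ V × V) :
    List V → List (V ⊕ V × V)
  | [] => []
  | _ :: t => t.foldl (ext A φh) (ext A φh [] v0)

theorem EL_snoc {V : Type} (A : Arena V) (v0 : V) (φh : List (V ⊕ V × V) → V ⊕ V × V)
    (a : V) (l : List V) (v : V) :
    EL A v0 φh (a :: (l ++ [v])) = ext A φh (EL A v0 φh (a :: l)) v := by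
  simp [EL, List.foldl_append]

theorem EL_pre {V : Type} (A : Arena V) (v0 : V) (φh : List (V ⊕ V × V) → V ⊕ V × V)
    (q : ℕ → V) (h0 : q 0 = v0) (n : ℕ) :
    EL A v0 φh (pre q (n+1)) = ext A φh (EL A v0 φh (pre q n)) (q n) := by
  rcases n with _ | n
  · simp [pre, EL, h0]
  · rw [pre_succ]
    rcases h : pre q (n+1) with _ | ⟨a, t⟩
    · have := congrArg List.length h
      simp [pre_len] at this
    · exact EL_snoc A v0 φh a t _

open Classical in
noncomputable def down {V : Type} (A : Arena V) (v0 : V) (φh : List (V ⊕ V × V) → V ⊕ V × V) :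
    List V → V := fun H =>
  match H.getLast? with
  | some v => if A.owner v = Player.E then
      ((φh (EL A v0 φh H.dropLast ++ [Sum.inl v])).getLeft?).getD v0 else v0
  | none => v0

open Classical in
theorem down_eq {V : Type} (A : Arena V) (v0 : V) (φh : List (V ⊕ V × V) → V ⊕ V × V)
    (l : List V) (v : V) : down A v0 φh (l ++ [v]) = if A.owner v = Player.E then
      ((φh (EL A v0 φh l ++ [Sum.inl v])).getLeft?).getD v0 else v0 := by
  simp [down]

theorem strat_E {V : Type} {A : Arena V} {φh : List (V ⊕ V × V) → V ⊕ V × V}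
    (hφ : IsStrategyFor (hatArena A) Player.E φh) (l : List (V ⊕ V × V)) (v : V)
    (hv : A.owner v = Player.E) : ∃ w, φh (l ++ [Sum.inl v]) = Sum.inl w ∧ A.Edge v w := by
  have h := hφ l (Sum.inl v) (by simp [hatArena, hv])
  rcases h' : φh (l ++ [Sum.inl v]) with w | w
  · rw [h'] at h; exact ⟨w, rfl, h.1⟩
  · rw [h'] at h; have := h.2.1; rw [hv] at this; cases this

theorem strat_N {V : Type} {A : Arena V} {φh : List (V ⊕ V × V) → V ⊕ V × V}
    (hφ : IsStrategyFor (hatArena A) Player.E φh) (l : List (V ⊕ V × V)) (v : V)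
    (hv : A.owner v = Player.N) : ∃ w, φh (l ++ [Sum.inl v]) = Sum.inr (v, w) ∧ A.Edge v w := by
  have h := hφ l (Sum.inl v) (by simp [hatArena, hv])
  rcases h' : φh (l ++ [Sum.inl v]) with w | ⟨a, w⟩
  · rw [h'] at h; exact absurd hv h.2
  · rw [h'] at h
    obtain ⟨h1, -, h2⟩ := h
    simp only at h1 h2
    exact ⟨w, by rw [h1], h2⟩

theorem down_strat {V : Type} {A : Arena V} (v0 : V) {φh : List (V ⊕ V × V) → V ⊕ V × V}
    (hφ : IsStrategyFor (hatArena A) Player.E φh) :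
    IsStrategyFor A Player.E (down A v0 φh) := by
  intro l v hv
  rw [down_eq, if_pos hv]
  obtain ⟨w, h1, h2⟩ := strat_E hφ (EL A v0 φh l) v hv
  rw [h1]
  exact h2

theorem down_pos {V : Type} {A : Arena V} (v0 : V) {φh : List (V ⊕ V × V) → V ⊕ V × V}
    (h : PositionalF φh) : PositionalF (down A v0 φh) := by
  classical
  obtain ⟨f, hf⟩ := h
  refine ⟨fun v => if A.owner v = Player.E then ((f (Sum.inl v)).getLeft?).getD v0 else v0, ?_⟩
  intro l v
  rw [down_eq, hf]

theorem ext_ne {V : Type} (A : Arena V) (φh : List (V ⊕ V × V) → V ⊕ V × V)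
    (l : List (V ⊕ V × V)) (v : V) : ext A φh l v ≠ [] := by
  unfold ext; split_ifs <;> simp

theorem down_fm {V : Type} {A : Arena V} (v0 : V) {φh : List (V ⊕ V × V) → V ⊕ V × V}
    (h : FiniteMemoryF φh) : FiniteMemoryF (down A v0 φh) := by
  classical
  obtain ⟨M, hM, m0, up, mov, hφ⟩ := h
  let upx : M → V → M := fun m w => if A.owner w = Player.N then
    up (up m (Sum.inl w)) (mov (up m (Sum.inl w)) (Sum.inl w)) else up m (Sum.inl w)
  let m0e : M := if A.owner v0 = Player.N then up m0 (mov m0 (Sum.inl v0)) else m0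
  let up' : Option M → V → Option M := fun o w => some (upx (o.getD m0e) w)
  have hne : ∀ a t, EL A v0 φh (a :: t) ≠ [] := by
    intro a t
    induction t using List.reverseRecOn with
    | nil => exact ext_ne _ _ _ _
    | append_singleton t w _ => rw [EL_snoc]; exact ext_ne _ _ _ _
  have key : ∀ a t, (EL A v0 φh (a :: t)).tail.foldl up m0 = t.foldl upx m0e := by
    intro a t
    induction t using List.reverseRecOn with
    | nil =>
      have := hφ [] (Sum.inl v0)
      simp only [List.nil_append, List.tail_cons, List.foldl_nil] at this
      simp only [EL, List.foldl_nil, ext, m0e]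
      split_ifs <;> simp [this]
    | append_singleton t w ih =>
      rw [EL_snoc, List.foldl_append, ← ih]
      have h2 := hφ (EL A v0 φh (a :: t)) (Sum.inl w)
      have h1 := hne a t
      generalize EL A v0 φh (a :: t) = X at *
      rw [List.tail_append_of_ne_nil h1, List.foldl_append] at h2
      simp only [ext, upx]
      split_ifs with hw
      · rw [List.tail_append_of_ne_nil h1, List.foldl_append]
        simp only [List.foldl_cons, List.foldl_nil] at h2 ⊢
        rw [h2, if_pos hw]
      · rw [List.tail_append_of_ne_nil h1, List.foldl_append]
        simp only [List.foldl_cons, List.foldl_nil]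
        rw [if_neg hw]
  have key2 : ∀ t w, (t ++ [w]).foldl up' none = some ((t ++ [w]).foldl upx m0e) := by
    intro t
    induction t using List.reverseRecOn with
    | nil => intro w; rfl
    | append_singleton t u ih => intro w; rw [List.foldl_append, ih, List.foldl_append (l' := [w])]; rfl
  refine ⟨Option M, inferInstance, none, up', fun o v => if A.owner v = Player.E then
    ((mov (o.getD m0) (Sum.inl v)).getLeft?).getD v0 else v0, ?_⟩
  intro l v
  rw [down_eq]
  split_ifs with hv
  · rw [hφ]
    rcases l with _ | ⟨a, t⟩
    · simp [EL, hv]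
    · rw [List.tail_append_of_ne_nil (hne a t), List.foldl_append, key]
      rw [List.cons_append, List.tail_cons, key2, List.foldl_append]
      simp [upx, hv]
  · simp [hv]

theorem lift_play {V : Type} {A : Arena V} {v0 : V} {φh : List (V ⊕ V × V) → V ⊕ V × V}
    (hφ : IsStrategyFor (hatArena A) Player.E φh) {q : ℕ → V} (hq : IsPlay A v0 q)
    (hqE : Respects A Player.E (down A v0 φh) q) :
    ∃ p k, IsPlay (hatArena A) (Sum.inl v0) p ∧ Respects (hatArena A) Player.E φh p ∧
      Corr A p k q ∧ ∀ n, pre p (k n + 1) = EL A v0 φh (pre q n) ++ [Sum.inl (q n)] := by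
  classical
  obtain ⟨hq0, hqe⟩ := hq
  have hs := EL_pre A v0 φh q hq0
  have : Nonempty (V ⊕ V × V) := ⟨Sum.inl v0⟩
  have hmono : ∀ n, EL A v0 φh (pre q n) ++ [Sum.inl (q n)] <+: EL A v0 φh (pre q (n+1)) := by
    intro n
    rw [hs, ext]
    split_ifs
    · exact ⟨[φh (EL A v0 φh (pre q n) ++ [Sum.inl (q n)])], by simp⟩
    · exact List.prefix_rfl
  have hlen : ∀ n, n ≤ (EL A v0 φh (pre q n)).length := by
    intro n
    induction n with
    | zero => simp
    | succ n ih =>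
      have := (hmono n).length_le
      simp at this
      omega
  obtain ⟨p, hp⟩ := limit (fun n => EL A v0 φh (pre q n))
    (fun n => (List.prefix_append _ _).trans (hmono n)) hlen
  let k : ℕ → ℕ := fun n => (EL A v0 φh (pre q n)).length
  have hp1 : ∀ n, pre p (k n + 1) = EL A v0 φh (pre q n) ++ [Sum.inl (q n)] := by
    intro n
    have h := hmono n
    rw [hp (n+1)] at h
    have := eq_pre_of_prefix h
    simp only [List.length_append, List.length_singleton] at this
    exact this.symm
  have hpk : ∀ n, p (k n) = Sum.inl (q n) := by
    intro n
    have := hp1 n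
    rw [pre_succ] at this
    simpa using (List.append_inj' this rfl).2
  have hk : ∀ n, (A.owner (q n) ≠ Player.N ∧ k (n+1) = k n + 1) ∨
     (A.owner (q n) = Player.N ∧ k (n+1) = k n + 2 ∧
      p (k n + 1) = φh (EL A v0 φh (pre q n) ++ [Sum.inl (q n)])) := by
    intro n
    have h1 := hs n
    by_cases h : A.owner (q n) = Player.N
    · right
      rw [ext, if_pos h] at h1
      have hk2 : k (n+1) = k n + 2 := by simp only [k]; rw [h1]; simp
      refine ⟨h, hk2, ?_⟩
      have h2 := hp (n+1)
      rw [show (EL A v0 φh (pre q (n+1))).length = k n + 2 from hk2, h1, pre_two] at h2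
      have := (List.append_inj' h2 rfl).2
      simp only [List.cons.injEq, and_true] at this
      exact this.2.symm
    · left
      rw [ext, if_neg h] at h1
      exact ⟨h, by simp only [k]; rw [h1]; simp⟩
  have hcorr : Corr A p k q := by
    refine ⟨by simp [k, pre, EL], fun n => ⟨hpk n, ?_⟩⟩
    rcases hk n with h | ⟨h1, h2, h3⟩
    · exact Or.inl h
    · obtain ⟨w, hw, -⟩ := strat_N hφ (EL A v0 φh (pre q n)) (q n) h1
      exact Or.inr ⟨h1, h2, w, by rw [h3, hw]⟩
  refine ⟨p, k, ⟨?_, ?_⟩, ?_, hcorr, hp1⟩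
  · have := hpk 0
    rwa [hcorr.1, hq0] at this
  · intro m
    obtain ⟨n, hn | ⟨hn, hN, hk2, w, hw⟩⟩ := hcorr.cover m
    · subst hn
      rcases hk n with ⟨h1, h2⟩ | ⟨h1, h2, h3⟩
      · rw [← h2, hpk, hpk]
        exact ⟨hqe n, h1⟩
      · obtain ⟨w, hw, he⟩ := strat_N hφ (EL A v0 φh (pre q n)) (q n) h1
        rw [h3, hw, hpk]
        exact ⟨rfl, h1, he⟩
    · rw [← hn, hw, show k n + 1 + 1 = k (n+1) by omega, hpk]
      exact hqe n
  · intro m hm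
    obtain ⟨n, hn | ⟨hn, hN, hk2, w, hw⟩⟩ := hcorr.cover m
    · subst hn
      rw [hist_eq, hp1]
      rcases hk n with ⟨h1, h2⟩ | ⟨h1, h2, h3⟩
      · rw [hpk] at hm
        have hE : A.owner (q n) = Player.E := by simpa [hatArena, h1] using hm
        rw [← h2, hpk, hqE n hE, hist_eq, pre_succ, down_eq, if_pos hE]
        obtain ⟨w, hw, -⟩ := strat_E hφ (EL A v0 φh (pre q n)) (q n) hE
        rw [hw]; rfl
      · exact h3
    · rw [← hn, hw] at hm
      simp [hatArena] at hm

theorem down_leak {V : Type} [Countable V] {A : Arena V} {v0 : V} {Ω : Set (ℕ → V)}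
    {φh : List (V ⊕ V × V) → V ⊕ V × V}
    (hφ : IsStrategyFor (hatArena A) Player.E φh)
    (hw : WinsE (hatArena A) (Sum.inl v0) (hatWC Ω) φh) :
    CL A v0 Ω (down A v0 φh) ≤ Cardinal.aleph0 := by
  classical
  apply ciSup_le'
  rintro ⟨φA, hA⟩
  simp only
  have key : ∀ q ∈ Outcomes A v0 (down A v0 φh) φA \ Ω, ∃ M, ∀ i ≥ M,
      A.owner (q i) = Player.N →
        φh (EL A v0 φh (pre q i) ++ [Sum.inl (q i)]) = Sum.inr (q i, q (i+1)) := by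
    rintro q ⟨⟨hq, hqE, hqA⟩, hqΩ⟩
    obtain ⟨p, k, h1, h2, h3, h4⟩ := lift_play hφ hq hqE
    rcases hw p h1 h2 with ⟨q', hq', hq''⟩ | hfin
    · rw [proj_unique hq' h3.proj] at hq''
      exact absurd hq'' hqΩ
    · obtain ⟨b, hb⟩ := hfin.bddAbove
      refine ⟨b + 1, fun i hi hN => ?_⟩
      obtain ⟨w, hw, he⟩ := strat_N hφ (EL A v0 φh (pre q i)) (q i) hN
      by_contra hne
      have hpk : p (k i + 1) = Sum.inr (q i, w) := by
        rw [← hw, ← h4 i, ← hist_eq]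
        apply h2
        rw [(h3.2 i).1]
        simp [hatArena, hN]
      obtain ⟨-, h5 | ⟨-, h5, -⟩⟩ := h3.2 i
      · exact h5.1 hN
      have hob : ObeysAt p (k i + 1) := by
        refine ⟨q i, w, q (i+1), hpk, ?_, ?_⟩
        · rw [show k i + 1 + 1 = k (i+1) by omega]
          exact (h3.2 (i+1)).1
        · rintro rfl
          exact hne hw
      have h6 := hb hob
      have h7 := h3.strictMono.le_apply (x := i)
      omega
  choose! M hM using key
  rw [Cardinal.mk_le_aleph0_iff]
  have hinj : Function.Injective (fun q : ↥(Outcomes A v0 (down A v0 φh) φA \ Ω) =>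
      pre q.1 (M q.1 + 1)) := by
    rintro ⟨q, hq⟩ ⟨r, hr⟩ h
    simp only at h
    have hMM : M q = M r := by
      have := congrArg List.length h
      simp only [pre_len] at this
      omega
    have hall : ∀ n, pre q (M q + 1 + n) = pre r (M q + 1 + n) := by
      intro n
      induction n with
      | zero => rw [add_zero, h, hMM]
      | succ n ih =>
        rw [← add_assoc, pre_succ, pre_succ, ih]
        have hi : M q + 1 + n = (M q + n) + 1 := by omega
        rw [hi] at ih ⊢
        have hl : q (M q + n) = r (M q + n) := pre_eq_apply ih (by omega)
        have hpre : pre q (M q + n) = pre r (M q + n) :=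
          pre_prefix_pre (by rw [← ih]; exact pre_prefix q (by omega))
        congr 2
        rcases ho : A.owner (q (M q + n)) with _ | _ | _
        · rw [hq.1.2.1 _ ho, hr.1.2.1 _ (by rw [← hl]; exact ho), hist_eq, hist_eq, ih]
        · rw [hq.1.2.2 _ ho, hr.1.2.2 _ (by rw [← hl]; exact ho), hist_eq, hist_eq, ih]
        · have e1 := hM q hq (M q + n) (by omega) ho
          have e2 := hM r hr (M q + n) (by omega) (by rw [← hl]; exact ho)
          rw [← hl, ← hpre, e1] at e2
          simpa using e2
    have : q = r := by
      funext i
      exact pre_eq_apply (hall i) (by omega)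
    subst this
    rfl
  exact hinj.countable

end LeakAux

/-- The leaking value of `G` is at most `ℵ₀` iff Éloïse has a
winning strategy in the associated game `Ĝ` without Nature; moreover from a
winning (resp. positional winning, resp. finite-memory winning) strategy of
Éloïse in `Ĝ` one can define a strategy (resp. positional, resp. finite-memory
strategy) for Éloïse in `G` whose cardinality leaking is at most `ℵ₀`. -/
theorem stmt2 {V : Type} [Countable V] (A : Arena V) (v0 : V)
    (Ω : Set (ℕ → V)) (hΩ : BorelWC Ω) :
    (LVal A v0 Ω ≤ Cardinal.aleph0 ↔
      ∃ φh, IsStrategyFor (hatArena A) Player.E φh ∧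
        WinsE (hatArena A) (Sum.inl v0) (hatWC Ω) φh) ∧
    (∀ φh, IsStrategyFor (hatArena A) Player.E φh →
      WinsE (hatArena A) (Sum.inl v0) (hatWC Ω) φh →
      ∃ φE, IsStrategyFor A Player.E φE ∧ CL A v0 Ω φE ≤ Cardinal.aleph0 ∧
        (PositionalF φh → PositionalF φE) ∧
        (FiniteMemoryF φh → FiniteMemoryF φE)) := by
  have part2 : ∀ φh, IsStrategyFor (hatArena A) Player.E φh →
      WinsE (hatArena A) (Sum.inl v0) (hatWC Ω) φh →
      ∃ φE, IsStrategyFor A Player.E φE ∧ CL A v0 Ω φE ≤ Cardinal.aleph0 ∧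
        (PositionalF φh → PositionalF φE) ∧
        (FiniteMemoryF φh → FiniteMemoryF φE) := fun φh h1 h2 =>
    ⟨LeakAux.down A v0 φh, LeakAux.down_strat v0 h1, LeakAux.down_leak h1 h2,
      LeakAux.down_pos v0, LeakAux.down_fm v0⟩
  refine ⟨⟨fun h => ?_, ?_⟩, part2⟩
  · choose s hs using A.no_dead
    have : Nonempty (EStrat A) :=
      ⟨⟨fun l => s (l.getLastD v0), fun l v _ => by simpa using hs v⟩⟩
    obtain ⟨⟨φE, hφE⟩, he⟩ := ciInf_mem (fun φE : EStrat A => CL A v0 Ω φE.1)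
    have hCL : CL A v0 Ω φE ≤ Cardinal.aleph0 := le_of_eq_of_le he h
    obtain ⟨C, hC1, hC2⟩ := LeakAux.exists_pred_borel A v0 φE Ω hΩ (fun φA hA =>
      le_trans (le_ciSup (f := fun φA : AStrat A => Cardinal.mk ↥(Outcomes A v0 φE φA.1 \ Ω))
        Cardinal.bddAbove_of_small ⟨φA, hA⟩) hCL)
    exact LeakAux.hat_wins A v0 Ω φE hφE C hC1 hC2
  · rintro ⟨φh, h1, h2⟩
    obtain ⟨φE, h3, h4, -⟩ := part2 φh h1 h2
    exact le_trans (ciInf_le' (fun φE : EStrat A => CL A v0 Ω φE.1) ⟨φE, h3⟩) h4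
end

section
/- Let G = (𝒢, Ω, v₀) be a game with Nature with Borel winning condition Ω in which Abélard does not play (V_A = ∅), v₀ ∈ V_E, and the game is turn-based (E ⊆ V_E × V_N ∪ V_N × V_E). Then Éloïse has a topologically-good strategy in G if and only if she has a winning strategy in the two-player game G̃. Moreover, from a winning strategy (resp. positional strategy, resp. finite-memory strategy) φ̃_E of Éloïse in G̃ one can define a topologically-good strategy (resp. positional strategy, resp. finite-memory strategy) φ_E for Éloïse in G. -/
open Cardinal

/-- The nodes of the tree of finite prefixes of a set `P` of infinite words. -/
def PrefixesOf {X : Type} (P : Set (ℕ → X)) : Set (List X) :=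
  {l | ∃ p ∈ P, BPrefix p l}

/-- `B` is nowhere dense in the tree whose set of branches is `P`:
below every node there is a node through which no branch of `B` passes. -/
def NowhereDenseIn {X : Type} (P B : Set (ℕ → X)) : Prop :=
  ∀ u ∈ PrefixesOf P, ∃ v ∈ PrefixesOf P, u <+: v ∧ ∀ b ∈ B, ¬ BPrefix b v

/-- `B` is meager in the tree whose set of branches is `P`:
a countable union of nowhere dense sets. -/
def MeagerIn {X : Type} (P B : Set (ℕ → X)) : Prop :=
  ∃ f : ℕ → Set (ℕ → X), (∀ n, NowhereDenseIn P (f n)) ∧ B ⊆ ⋃ n, f n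

/-- An Éloïse strategy is topologically-good if, against every Abélard strategy,
the set of plays she loses is meager in the tree of outcomes. -/
def TopGood {V : Type} (A : Arena V) (v0 : V) (Ω : Set (ℕ → V)) (φE : List V → V) : Prop :=
  ∀ φA, IsStrategyFor A Player.A φA →
    MeagerIn (Outcomes A v0 φE φA) (Outcomes A v0 φE φA \ Ω)
/-- The arena of the game `G̃` without Nature associated with a turn-based
Éloïse–Nature game: Éloïse owns the vertices of `V` and Abélard owns the triples
`(v', w, b)`.  From `v` Éloïse moves to `(v', w, b)` with `v' ∈ E(v)` and
`w ∈ E(v')` (indicating the direction mapping `w` and, via `b`, membership of the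
current node in the dense set), and from `(v', w, b)` Abélard moves to any
`w' ∈ E(v')`. -/
def tildeArena {V : Type} (A : Arena V) : Arena (V ⊕ V × V × Bool) where
  Edge x y :=
    match x, y with
    | Sum.inl v, Sum.inr z => A.Edge v z.1 ∧ A.Edge z.1 z.2.1
    | Sum.inr z, Sum.inl w' => A.Edge z.1 w'
    | _, _ => False
  owner x :=
    match x with
    | Sum.inl _ => Player.E
    | Sum.inr _ => Player.A
  no_dead := by
    rintro (v | z)
    · obtain ⟨w, hw⟩ := A.no_dead v
      obtain ⟨w', hw'⟩ := A.no_dead w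
      exact ⟨Sum.inr (w, w', true), hw, hw'⟩
    · obtain ⟨w', hw'⟩ := A.no_dead z.1
      exact ⟨Sum.inl w', hw'⟩

/-- Interleaving of two infinite sequences: `a 0, b 0, a 1, b 1, …`. -/
def interleave {V : Type} (a b : ℕ → V) : ℕ → V :=
  fun m => if m % 2 = 0 then a (m / 2) else b (m / 2)

/-- The winning condition of `G̃`: plays
`v₀ (v₀', w₀, b₀) v₁ (v₁', w₁, b₁) v₂ ⋯` such that either the interleaved play
`v₀ v₀' v₁ v₁' v₂ ⋯` belongs to `Ω` and `b_j = ⊤` for infinitely many `j`, or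
`b_j = ⊤` for only finitely many `j` and `v_{j+1} ≠ w_j` for infinitely many `j`. -/
def tildeWC {V : Type} (Ω : Set (ℕ → V)) : Set (ℕ → V ⊕ V × V × Bool) :=
  {p | ∃ (vs vs' ws : ℕ → V) (bs : ℕ → Bool),
    (∀ n, p (2 * n) = Sum.inl (vs n)) ∧
    (∀ n, p (2 * n + 1) = Sum.inr (vs' n, ws n, bs n)) ∧
    ((interleave vs vs' ∈ Ω ∧ {j | bs j = true}.Infinite) ∨
     ({j | bs j = true}.Finite ∧ {j | vs (j + 1) ≠ ws j}.Infinite))}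
theorem histUpTo_zero' {V : Type} (p : ℕ → V) : histUpTo p 0 = [p 0] := by
  simp [histUpTo]

theorem histUpTo_succ' {V : Type} (p : ℕ → V) (i : ℕ) :
    histUpTo p (i + 1) = histUpTo p i ++ [p (i + 1)] := by
  unfold histUpTo
  rw [List.ofFn_succ_last]
  simp

theorem histUpTo_snoc {V : Type} (p : ℕ → V) (i : ℕ) :
    ∃ l, histUpTo p i = l ++ [p i] := by
  cases i with
  | zero => exact ⟨[], by simp [histUpTo_zero']⟩
  | succ i => exact ⟨_, histUpTo_succ' p i⟩

theorem histUpTo_length {V : Type} (p : ℕ → V) (i : ℕ) : (histUpTo p i).length = i + 1 := by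
  simp [histUpTo]

theorem histUpTo_ne {V : Type} (p : ℕ → V) (i : ℕ) : histUpTo p i ≠ [] := by
  intro h
  have := histUpTo_length p i
  simp [h] at this

theorem histUpTo_congr {V : Type} {p q : ℕ → V} {i : ℕ} (h : ∀ j ≤ i, p j = q j) :
    histUpTo p i = histUpTo q i := by
  unfold histUpTo
  congr 1
  funext j
  exact h _ (by omega)

theorem histUpTo_map {V W : Type} (f : V → W) (p : ℕ → V) (i : ℕ) :
    (histUpTo p i).map f = histUpTo (fun n => f (p n)) i := by
  simp [histUpTo, List.map_ofFn]; rfl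

theorem hist_getElem {V : Type} (p : ℕ → V) (i j : ℕ) (h : j < (histUpTo p i).length) :
    (histUpTo p i)[j] = p j := by
  exact List.getElem_ofFn (f := fun j : Fin (i + 1) => p j.1) h

theorem bprefix_hist {V : Type} (p q : ℕ → V) (i : ℕ) :
    BPrefix p (histUpTo q i) ↔ ∀ j ≤ i, p j = q j := by
  unfold BPrefix
  constructor
  · intro h j hj
    have := h ⟨j, by rw [histUpTo_length]; omega⟩
    rwa [List.get_eq_getElem, hist_getElem] at this
  · intro h j
    have hj : j.1 < i + 1 := lt_of_lt_of_eq j.2 (histUpTo_length q i)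
    rw [List.get_eq_getElem, hist_getElem]
    exact h j.1 (by omega)

theorem exists_follow {V : Type} (g : List V → V) (p : ℕ → V) (i0 : ℕ) :
    ∃ q : ℕ → V, (∀ i ≤ i0, q i = p i) ∧ ∀ i, i0 ≤ i → q (i + 1) = g (histUpTo q i) := by
  classical
  let g' : List V → V := fun l => if l.length ≤ i0 then p l.length else g l
  let L : ℕ → List V := fun n => Nat.rec [] (fun _ l => l ++ [g' l]) n
  have hL : ∀ n, L (n + 1) = L n ++ [g' (L n)] := fun n => rfl
  have hlen : ∀ n, (L n).length = n := by
    intro n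
    induction n with
    | zero => rfl
    | succ n ih => rw [hL]; simp [ih]
  let q : ℕ → V := fun n => g' (L n)
  have hq : ∀ n, L (n + 1) = histUpTo q n := by
    intro n
    induction n with
    | zero => rw [histUpTo_zero', hL]; rfl
    | succ n ih => rw [histUpTo_succ', ← ih]
  refine ⟨q, ?_, ?_⟩
  · intro i hi
    simp [q, g', hlen, hi]
  · intro i hi
    rw [← hq]
    have : ¬ (i + 1 ≤ i0) := by omega
    simp [q, g', hlen, this]

section Back

def pr1 {V : Type} : V ⊕ V × V × Bool → V
  | Sum.inl v => v
  | Sum.inr z => z.1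
def prw {V : Type} : V ⊕ V × V × Bool → V
  | Sum.inl v => v
  | Sum.inr z => z.2.1
def prb {V : Type} : V ⊕ V × V × Bool → Bool
  | Sum.inl _ => false
  | Sum.inr z => z.2.2

def stepS {V : Type} (A : Arena V) (φt : List (V ⊕ V × V × Bool) → V ⊕ V × V × Bool)
    (S : List (V ⊕ V × V × Bool)) (v : V) : List (V ⊕ V × V × Bool) :=
  if A.owner v = Player.E then S ++ [φt S, Sum.inl v] else S

def SH {V : Type} (A : Arena V) (v0 : V)
    (φt : List (V ⊕ V × V × Bool) → V ⊕ V × V × Bool) (l : List V) :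
    List (V ⊕ V × V × Bool) :=
  l.tail.foldl (stepS A φt) [Sum.inl v0]

def phiE {V : Type} (A : Arena V) (v0 : V)
    (φt : List (V ⊕ V × V × Bool) → V ⊕ V × V × Bool) (l : List V) : V :=
  match l.getLast? with
  | none => v0
  | some v => if A.owner v = Player.E then
      pr1 (φt ((SH A v0 φt l).dropLast ++ [Sum.inl v])) else v0

theorem phiE_snoc {V : Type} (A : Arena V) (v0 : V)
    (φt : List (V ⊕ V × V × Bool) → V ⊕ V × V × Bool) (l : List V) (v : V) :
    phiE A v0 φt (l ++ [v]) = if A.owner v = Player.E then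
      pr1 (φt ((SH A v0 φt (l ++ [v])).dropLast ++ [Sum.inl v])) else v0 := by
  simp [phiE]

theorem SH_snoc {V : Type} (A : Arena V) (v0 : V)
    (φt : List (V ⊕ V × V × Bool) → V ⊕ V × V × Bool) (l : List V) (hl : l ≠ []) (v : V) :
    SH A v0 φt (l ++ [v]) = stepS A φt (SH A v0 φt l) v := by
  cases l with
  | nil => exact absurd rfl hl
  | cons a t => simp [SH]

theorem phit_form {V : Type} {A : Arena V}
    {φt : List (V ⊕ V × V × Bool) → V ⊕ V × V × Bool}
    (hs : IsStrategyFor (tildeArena A) Player.E φt) (l : List (V ⊕ V × V × Bool)) (v : V) :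
    ∃ z : V × V × Bool, φt (l ++ [Sum.inl v]) = Sum.inr z ∧ A.Edge v z.1 ∧ A.Edge z.1 z.2.1 := by
  have h := hs l (Sum.inl v) rfl
  rcases hz : φt (l ++ [Sum.inl v]) with a | z
  · rw [hz] at h; exact h.elim
  · rw [hz] at h; exact ⟨z, rfl, h⟩

theorem phiE_strat {V : Type} {A : Arena V} (v0 : V)
    {φt : List (V ⊕ V × V × Bool) → V ⊕ V × V × Bool}
    (hs : IsStrategyFor (tildeArena A) Player.E φt) :
    IsStrategyFor A Player.E (phiE A v0 φt) := by
  intro l v hv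
  rw [phiE_snoc, if_pos hv]
  obtain ⟨z, hz, h1, h2⟩ := phit_form hs (SH A v0 φt (l ++ [v])).dropLast v
  rw [hz]; exact h1

theorem phiE_pos {V : Type} {A : Arena V} (v0 : V)
    {φt : List (V ⊕ V × V × Bool) → V ⊕ V × V × Bool}
    (h : PositionalF φt) : PositionalF (phiE A v0 φt) := by
  obtain ⟨f, hf⟩ := h
  refine ⟨fun v => if A.owner v = Player.E then pr1 (f (Sum.inl v)) else v0, ?_⟩
  intro l v
  rw [phiE_snoc, hf]

theorem SH_last {V : Type} (A : Arena V) (v0 : V)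
    (φt : List (V ⊕ V × V × Bool) → V ⊕ V × V × Bool) (l : List V) :
    ∃ S e, SH A v0 φt l = S ++ [Sum.inl e] := by
  induction l using List.reverseRecOn with
  | nil => exact ⟨[], v0, rfl⟩
  | append_singleton l v ih =>
    by_cases hl : l = []
    · subst hl; exact ⟨[], v0, rfl⟩
    · rw [SH_snoc _ _ _ _ hl]
      unfold stepS
      split_ifs
      · exact ⟨SH A v0 φt l ++ [φt (SH A v0 φt l)], v, by simp⟩
      · exact ih

theorem phiE_fin {V : Type} {A : Arena V} (v0 : V)
    {φt : List (V ⊕ V × V × Bool) → V ⊕ V × V × Bool}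
    (h : FiniteMemoryF φt) : FiniteMemoryF (phiE A v0 φt) := by
  obtain ⟨M, hM, m0, up, mov, hm⟩ := h
  let up' : M × M → V → M × M := fun m v =>
    if A.owner v = Player.E then
      (up m.2 (Sum.inl v), up (up m.2 (Sum.inl v)) (mov (up m.2 (Sum.inl v)) (Sum.inl v))) else m
  let m0' : M × M := (m0, up m0 (mov m0 (Sum.inl v0)))
  have key : ∀ l : List V, l.tail.foldl up' m0' =
      ((SH A v0 φt l).tail.foldl up m0,
        (SH A v0 φt l ++ [φt (SH A v0 φt l)]).tail.foldl up m0) := by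
    intro l
    have base : m0' = (([Sum.inl v0] : List (V ⊕ V × V × Bool)).tail.foldl up m0,
        ([Sum.inl v0] ++ [φt [Sum.inl v0]]).tail.foldl up m0) := by
      have := hm [] (Sum.inl v0)
      simp at this
      simp [m0', this]
    induction l using List.reverseRecOn with
    | nil => exact base
    | append_singleton l v ih =>
      by_cases hl : l = []
      · subst hl; exact base
      · rw [SH_snoc _ _ _ _ hl, List.tail_append_of_ne_nil hl, List.foldl_append, ih]
        obtain ⟨S, e, hS⟩ := SH_last A v0 φt l
        have hne : SH A v0 φt l ≠ [] := by rw [hS]; simp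
        simp only [List.foldl_cons, List.foldl_nil, stepS, up']
        split_ifs with hv
        · have h2 := hm (SH A v0 φt l ++ [φt (SH A v0 φt l)]) (Sum.inl v)
          simp only [List.append_assoc, List.cons_append, List.nil_append] at h2
          simp [List.tail_append_of_ne_nil hne, List.foldl_append] at h2 ⊢
          rw [h2]
        · rfl
  refine ⟨M × M, inferInstance, m0', up', fun m v =>
    if A.owner v = Player.E then pr1 (mov m.1 (Sum.inl v)) else v0, ?_⟩
  intro l v
  rw [phiE_snoc, key, hm]
  by_cases hv : A.owner v = Player.E
  · simp only [if_pos hv]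
    congr 2
    by_cases hl : l = []
    · subst hl; rfl
    · rw [SH_snoc _ _ _ _ hl]
      simp [stepS, hv]
  · simp only [if_neg hv]

/-- tilde history -/
def TH {V : Type} (φt : List (V ⊕ V × V × Bool) → V ⊕ V × V × Bool) (q : ℕ → V) :
    ℕ → List (V ⊕ V × V × Bool)
  | 0 => [Sum.inl (q 0)]
  | j + 1 => TH φt q j ++ [φt (TH φt q j), Sum.inl (q (2 * j + 2))]

theorem TH_snoc {V : Type} (φt : List (V ⊕ V × V × Bool) → V ⊕ V × V × Bool) (q : ℕ → V)
    (j : ℕ) : ∃ l, TH φt q j = l ++ [Sum.inl (q (2 * j))] := by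
  cases j with
  | zero => exact ⟨[], rfl⟩
  | succ j => exact ⟨TH φt q j ++ [φt (TH φt q j)], by simp [TH, Nat.mul_succ]⟩

theorem TH_congr {V : Type} (φt : List (V ⊕ V × V × Bool) → V ⊕ V × V × Bool) {q q' : ℕ → V}
    (j : ℕ) (h : ∀ i ≤ 2 * j, q i = q' i) : TH φt q j = TH φt q' j := by
  induction j with
  | zero => simp [TH, h 0 (by omega)]
  | succ j ih =>
    have := ih (fun i hi => h i (by omega))
    simp [TH, this, h (2 * j + 2) (by omega)]

theorem owner_parity {V : Type} {A : Arena V} {v0 : V} (hv0 : A.owner v0 = Player.E)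
    (hturn : ∀ v w, A.Edge v w →
      (A.owner v = Player.E ∧ A.owner w = Player.N) ∨
      (A.owner v = Player.N ∧ A.owner w = Player.E))
    {q : ℕ → V} (hq : IsPlay A v0 q) (j : ℕ) :
    A.owner (q (2 * j)) = Player.E ∧ A.owner (q (2 * j + 1)) = Player.N := by
  have aux : ∀ j, A.owner (q (2 * j)) = Player.E → A.owner (q (2 * j + 1)) = Player.N := by
    intro j h
    rcases hturn _ _ (hq.2 (2 * j)) with h' | h'
    · exact h'.2
    · rw [h] at h'; simp at h'
  induction j with
  | zero =>
    have : A.owner (q (2 * 0)) = Player.E := by simpa [hq.1] using hv0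
    exact ⟨this, aux 0 this⟩
  | succ j ih =>
    have : A.owner (q (2 * (j + 1))) = Player.E := by
      rcases hturn _ _ (hq.2 (2 * j + 1)) with h' | h'
      · rw [ih.2] at h'; simp at h'
      · exact h'.2
    exact ⟨this, aux _ this⟩

theorem SH_eq_TH {V : Type} {A : Arena V} {v0 : V} (hv0 : A.owner v0 = Player.E)
    (hturn : ∀ v w, A.Edge v w →
      (A.owner v = Player.E ∧ A.owner w = Player.N) ∨
      (A.owner v = Player.N ∧ A.owner w = Player.E))
    (φt : List (V ⊕ V × V × Bool) → V ⊕ V × V × Bool)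
    {q : ℕ → V} (hq : IsPlay A v0 q) (j : ℕ) :
    SH A v0 φt (histUpTo q (2 * j)) = TH φt q j ∧
    SH A v0 φt (histUpTo q (2 * j + 1)) = TH φt q j := by
  have aux : ∀ j, SH A v0 φt (histUpTo q (2 * j)) = TH φt q j →
      SH A v0 φt (histUpTo q (2 * j + 1)) = TH φt q j := by
    intro j h
    rw [histUpTo_succ', SH_snoc _ _ _ _ (histUpTo_ne _ _), h, stepS,
      (owner_parity hv0 hturn hq j).2]
    simp
  induction j with
  | zero =>
    have : SH A v0 φt (histUpTo q (2 * 0)) = TH φt q 0 := by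
      simp [histUpTo_zero', SH, TH, hq.1]
    exact ⟨this, aux 0 this⟩
  | succ j ih =>
    have : SH A v0 φt (histUpTo q (2 * (j + 1))) = TH φt q (j + 1) := by
      have ho := (owner_parity hv0 hturn hq (j + 1)).1
      rw [Nat.mul_succ] at ho ⊢
      rw [histUpTo_succ', SH_snoc _ _ _ _ (histUpTo_ne _ _), ih.2, stepS, if_pos ho]
      rfl
    exact ⟨this, aux _ this⟩

theorem phiE_TH {V : Type} {A : Arena V} {v0 : V} (hv0 : A.owner v0 = Player.E)
    (hturn : ∀ v w, A.Edge v w →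
      (A.owner v = Player.E ∧ A.owner w = Player.N) ∨
      (A.owner v = Player.N ∧ A.owner w = Player.E))
    (φt : List (V ⊕ V × V × Bool) → V ⊕ V × V × Bool)
    {q : ℕ → V} (hq : IsPlay A v0 q) (j : ℕ) :
    phiE A v0 φt (histUpTo q (2 * j)) = pr1 (φt (TH φt q j)) := by
  obtain ⟨l, hl⟩ := histUpTo_snoc q (2 * j)
  rw [hl, phiE_snoc, if_pos (owner_parity hv0 hturn hq j).1, ← hl,
    (SH_eq_TH hv0 hturn φt hq j).1]
  obtain ⟨l', hl'⟩ := TH_snoc φt q j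
  rw [hl']; simp

theorem key_win {V : Type} {A : Arena V} {v0 : V} {Ω : Set (ℕ → V)}
    (hv0 : A.owner v0 = Player.E)
    (hturn : ∀ v w, A.Edge v w →
      (A.owner v = Player.E ∧ A.owner w = Player.N) ∨
      (A.owner v = Player.N ∧ A.owner w = Player.E))
    {φt : List (V ⊕ V × V × Bool) → V ⊕ V × V × Bool}
    (hs : IsStrategyFor (tildeArena A) Player.E φt)
    (hw : WinsE (tildeArena A) (Sum.inl v0) (tildeWC Ω) φt)
    {q : ℕ → V} (hq : IsPlay A v0 q) (hr : Respects A Player.E (phiE A v0 φt) q) :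
    (q ∈ Ω ∧ {j | prb (φt (TH φt q j)) = true}.Infinite) ∨
    ({j | prb (φt (TH φt q j)) = true}.Finite ∧
      {j | q (2 * j + 2) ≠ prw (φt (TH φt q j))}.Infinite) := by
  let pt : ℕ → V ⊕ V × V × Bool := fun n =>
    if n % 2 = 0 then Sum.inl (q n) else φt (TH φt q (n / 2))
  have pe : ∀ j, pt (2 * j) = Sum.inl (q (2 * j)) := by intro j; simp [pt]
  have po : ∀ j, pt (2 * j + 1) = φt (TH φt q j) := by
    intro j
    have h1 : (2 * j + 1) % 2 = 1 := by omega
    have h2 : (2 * j + 1) / 2 = j := by omega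
    simp [pt, h1, h2]
  have hform : ∀ j, ∃ z : V × V × Bool, φt (TH φt q j) = Sum.inr z ∧ z.1 = q (2 * j + 1) ∧
      A.Edge (q (2 * j)) z.1 ∧ A.Edge z.1 z.2.1 := by
    intro j
    obtain ⟨l, hl⟩ := TH_snoc φt q j
    obtain ⟨z, hz, h1, h2⟩ := phit_form hs l (q (2 * j))
    rw [← hl] at hz
    refine ⟨z, hz, ?_, h1, h2⟩
    rw [hr _ (owner_parity hv0 hturn hq j).1, phiE_TH hv0 hturn φt hq, hz]
    rfl
  have hhist : ∀ j, histUpTo pt (2 * j) = TH φt q j := by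
    intro j
    induction j with
    | zero =>
      rw [Nat.mul_zero, histUpTo_zero']
      simp [pt, TH]
    | succ j ih =>
      have := pe (j + 1)
      rw [Nat.mul_succ] at this ⊢
      rw [histUpTo_succ', histUpTo_succ', ih, po, this]
      simp [TH]
  have hplay : IsPlay (tildeArena A) (Sum.inl v0) pt := by
    refine ⟨by simp [pt, hq.1], ?_⟩
    intro i
    rcases Nat.even_or_odd' i with ⟨j, rfl | rfl⟩
    · rw [pe, po]
      obtain ⟨z, hz, h0, h1, h2⟩ := hform j
      rw [hz]; exact ⟨h1, h2⟩
    · have := pe (j + 1)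
      rw [Nat.mul_succ] at this
      rw [po, this]
      obtain ⟨z, hz, h0, h1, h2⟩ := hform j
      rw [hz]
      change A.Edge z.1 _
      rw [h0]
      exact hq.2 _
  have hresp : Respects (tildeArena A) Player.E φt pt := by
    intro i hi
    rcases Nat.even_or_odd' i with ⟨j, rfl | rfl⟩
    · rw [hhist, po]
    · rw [po] at hi
      obtain ⟨z, hz, h0, h1, h2⟩ := hform j
      rw [hz] at hi
      cases hi
  obtain ⟨vs, vs', ws, bs, h1, h2, h3⟩ := hw pt hplay hresp
  have e1 : ∀ n, vs n = q (2 * n) := by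
    intro n
    have := h1 n
    rw [pe] at this
    exact (Sum.inl.inj this).symm
  have e2 : ∀ n, φt (TH φt q n) = Sum.inr (vs' n, ws n, bs n) := by
    intro n
    rw [← po, h2]
  have e3 : ∀ n, vs' n = q (2 * n + 1) := by
    intro n
    obtain ⟨z, hz, h0, -, -⟩ := hform n
    rw [e2] at hz
    rw [← h0, ← Sum.inr.inj hz]
  have e4 : interleave vs vs' = q := by
    funext m
    rcases Nat.even_or_odd' m with ⟨j, rfl | rfl⟩
    · simp [interleave, e1]
    · have h1 : (2 * j + 1) % 2 = 1 := by omega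
      have h2 : (2 * j + 1) / 2 = j := by omega
      simp [interleave, h1, h2, e3]
  rw [e4] at h3
  have e5 : ∀ n, vs (n + 1) = q (2 * n + 2) := fun n => by rw [e1, Nat.mul_succ]
  simpa [e2, e5, prb, prw] using h3

theorem back_topgood {V : Type} {A : Arena V} {v0 : V} {Ω : Set (ℕ → V)}
    (hNoA : ∀ v, A.owner v ≠ Player.A)
    (hv0 : A.owner v0 = Player.E)
    (hturn : ∀ v w, A.Edge v w →
      (A.owner v = Player.E ∧ A.owner w = Player.N) ∨
      (A.owner v = Player.N ∧ A.owner w = Player.E))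
    {φt : List (V ⊕ V × V × Bool) → V ⊕ V × V × Bool}
    (hs : IsStrategyFor (tildeArena A) Player.E φt)
    (hw : WinsE (tildeArena A) (Sum.inl v0) (tildeWC Ω) φt) :
    TopGood A v0 Ω (phiE A v0 φt) := by
  classical
  intro φA _
  refine ⟨fun n => {p | ∀ j ≥ n, prb (φt (TH φt p j)) = false}, ?_, ?_⟩
  · rintro n u ⟨p, ⟨hp, hpE, hpA⟩, hpu⟩
    choose succ hsucc using A.no_dead
    let g : List V → V := fun l => match l.getLast? with
      | none => v0
      | some v => if A.owner v = Player.E then phiE A v0 φt l else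
          if A.Edge v (prw (φt (SH A v0 φt l))) then prw (φt (SH A v0 φt l)) else succ v
    have hg : ∀ l v, g (l ++ [v]) = if A.owner v = Player.E then phiE A v0 φt (l ++ [v]) else
          if A.Edge v (prw (φt (SH A v0 φt (l ++ [v])))) then
            prw (φt (SH A v0 φt (l ++ [v]))) else succ v := by
      intro l v; simp [g]
    obtain ⟨q, hq1, hq2⟩ := exists_follow g p u.length
    have hq2' : ∀ i, u.length ≤ i → q (i + 1) =
        if A.owner (q i) = Player.E then phiE A v0 φt (histUpTo q i) else
          if A.Edge (q i) (prw (φt (SH A v0 φt (histUpTo q i)))) then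
            prw (φt (SH A v0 φt (histUpTo q i))) else succ (q i) := by
      intro i hi
      obtain ⟨l, hl⟩ := histUpTo_snoc q i
      rw [hq2 i hi, hl, hg]
    have hplay : IsPlay A v0 q := by
      refine ⟨by rw [hq1 0 (by omega)]; exact hp.1, ?_⟩
      intro i
      by_cases hi : u.length ≤ i
      · rw [hq2' i hi]
        split_ifs with h1 h2
        · obtain ⟨l, hl⟩ := histUpTo_snoc q i
          rw [hl]
          exact phiE_strat v0 hs l _ h1
        · exact h2
        · exact hsucc _
      · rw [hq1 i (by omega), hq1 (i + 1) (by omega)]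
        exact hp.2 i
    have hresp : Respects A Player.E (phiE A v0 φt) q := by
      intro i ho
      by_cases hi : u.length ≤ i
      · rw [hq2' i hi, if_pos ho]
      · rw [hq1 (i + 1) (by omega), histUpTo_congr (fun j hj => hq1 j (by omega))]
        rw [hq1 i (by omega)] at ho
        exact hpE i ho
    have hout : q ∈ Outcomes A v0 (phiE A v0 φt) φA :=
      ⟨hplay, hresp, fun i hi => absurd hi (hNoA _)⟩
    have hinf : {j | prb (φt (TH φt q j)) = true}.Infinite := by
      rcases key_win hv0 hturn hs hw hplay hresp with h | h
      · exact h.2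
      · exfalso
        apply h.2
        apply (Set.finite_lt_nat u.length).subset
        intro j hj
        by_contra hlt
        apply hj
        have hlt' : u.length ≤ j := by simpa using hlt
        have ho := (owner_parity hv0 hturn hplay j).2
        have e := hq2' (2 * j + 1) (by omega)
        rw [if_neg (by rw [ho]; simp), (SH_eq_TH hv0 hturn φt hplay j).2] at e
        rw [e, if_pos]
        obtain ⟨l, hl⟩ := TH_snoc φt q j
        obtain ⟨z, hz, h1, h2⟩ := phit_form hs l (q (2 * j))
        rw [← hl] at hz
        rw [hresp _ (owner_parity hv0 hturn hplay j).1, phiE_TH hv0 hturn φt hplay, hz]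
        exact h2
    obtain ⟨j, hj, hjn⟩ := hinf.exists_gt (n + u.length)
    have hqu : BPrefix q u := by
      intro i
      rw [hq1 i.1 (by omega)]
      exact hpu i
    refine ⟨histUpTo q (2 * j), ⟨q, hout, (bprefix_hist _ _ _).2 (fun _ _ => rfl)⟩, ?_, ?_⟩
    · rw [List.prefix_iff_eq_take]
      apply List.ext_getElem
      · simp [histUpTo_length]; omega
      · intro i h1 h2
        have := hqu ⟨i, h1⟩
        rw [List.getElem_take, hist_getElem]
        exact this.symm
    · intro b hb hbq
      rw [bprefix_hist] at hbq
      have h1 := hb j (by omega)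
      rw [TH_congr φt j hbq] at h1
      simp only [Set.mem_ofPred_eq] at hj
      rw [hj] at h1
      cases h1
  · rintro q ⟨⟨hq, hr, -⟩, hqΩ⟩
    rcases key_win hv0 hturn hs hw hq hr with h | h
    · exact absurd h.1 hqΩ
    · obtain ⟨N, hN⟩ := h.1.bddAbove
      refine Set.mem_iUnion.2 ⟨N + 1, ?_⟩
      intro j hj
      by_contra hc
      have := hN (show j ∈ {j | prb (φt (TH φt q j)) = true} by simpa using hc)
      omega

end Back

def isTop {V : Type} (x : V ⊕ V × V × Bool) : Bool := prb x

theorem forward {V : Type} {A : Arena V} {v0 : V} {Ω : Set (ℕ → V)}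
    (hNoA : ∀ v, A.owner v ≠ Player.A)
    (hv0 : A.owner v0 = Player.E)
    (hturn : ∀ v w, A.Edge v w →
      (A.owner v = Player.E ∧ A.owner w = Player.N) ∨
      (A.owner v = Player.N ∧ A.owner w = Player.E))
    {φE : List V → V} (hs : IsStrategyFor A Player.E φE) (hg : TopGood A v0 Ω φE) :
    ∃ φt, IsStrategyFor (tildeArena A) Player.E φt ∧
        WinsE (tildeArena A) (Sum.inl v0) (tildeWC Ω) φt := by
  classical
  obtain ⟨f, hf, hcov⟩ := hg (fun _ => v0) (fun l v hv => absurd hv (hNoA v))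
  set P := Outcomes A v0 φE (fun _ => v0) with hP
  let reach : ℕ → List V → ℕ → Prop := fun n u k =>
    ∃ p ∈ P, BPrefix p u ∧ ∀ b ∈ f n, ¬ ∀ i < u.length + k, b i = p i
  have hspec : ∀ (n : ℕ) (l : List V) (v : V), ∃ z : V × V × Bool,
      A.Edge v z.1 ∧ A.Edge z.1 z.2.1 ∧
      (A.owner v = Player.E → z.1 = φE (l ++ [v]) ∧
        (z.2.2 = true ↔ ∀ b ∈ f n, ¬ BPrefix b (l ++ [v])) ∧
        ∀ k, reach n (l ++ [v]) k → ∃ p ∈ P, BPrefix p (l ++ [v]) ∧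
          p ((l ++ [v]).length + 1) = z.2.1 ∧
          ∀ b ∈ f n, ¬ ∀ i < (l ++ [v]).length + k, b i = p i) := by
    intro n l v
    by_cases hv : A.owner v = Player.E
    · have hE := hs l v hv
      by_cases hr : ∃ k, reach n (l ++ [v]) k
      · obtain ⟨p, hp, hpu, hpk⟩ := Nat.find_spec hr
        have hpl : p l.length = v := by
          have := hpu ⟨l.length, by simp⟩
          simpa using this
        have hpre : histUpTo p l.length = l ++ [v] := by
          apply List.ext_getElem
          · simp [histUpTo_length]
          · intro i h1 h2
            have := hpu ⟨i, h2⟩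
            simp only [List.get_eq_getElem] at this
            rw [← this, hist_getElem]
        have hnext : p (l.length + 1) = φE (l ++ [v]) := by
          rw [← hpre]
          exact hp.2.1 _ (by rw [hpl]; exact hv)
        refine ⟨(φE (l ++ [v]), p ((l ++ [v]).length + 1),
          decide (∀ b ∈ f n, ¬ BPrefix b (l ++ [v]))), hE, ?_, fun _ => ⟨rfl, by simp, ?_⟩⟩
        · have := hp.1.2 (l.length + 1)
          rw [hnext] at this
          simpa using this
        · intro k hk
          refine ⟨p, hp, hpu, rfl, ?_⟩
          intro b hb hbk
          refine hpk b hb (fun i hi => hbk i ?_)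
          have := Nat.find_min' hr hk
          omega
      · obtain ⟨w, hw⟩ := A.no_dead (φE (l ++ [v]))
        exact ⟨(φE (l ++ [v]), w, decide (∀ b ∈ f n, ¬ BPrefix b (l ++ [v]))), hE, hw,
          fun _ => ⟨rfl, by simp, fun k hk => absurd ⟨k, hk⟩ hr⟩⟩
    · obtain ⟨w, hw⟩ := A.no_dead v
      obtain ⟨w', hw'⟩ := A.no_dead w
      exact ⟨(w, w', true), hw, hw', fun h => absurd h hv⟩
  choose Z hZ1 hZ2 hZ3 using hspec
  let cnt : List (V ⊕ V × V × Bool) → ℕ := fun H => H.countP prb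
  let φt : List (V ⊕ V × V × Bool) → V ⊕ V × V × Bool := fun H =>
    match H.getLast? with
    | some (Sum.inl v) => Sum.inr (Z (cnt H) (H.dropLast.map pr1) v)
    | _ => Sum.inl v0
  have hφt : ∀ l v, φt (l ++ [Sum.inl v]) =
      Sum.inr (Z (cnt (l ++ [Sum.inl v])) (l.map pr1) v) := by
    intro l v; simp [φt]
  refine ⟨φt, ?_, ?_⟩
  · rintro l (v | z) hv
    · rw [hφt]
      exact ⟨hZ1 _ _ _, hZ2 _ _ _⟩
    · cases hv
  intro pt hplay hresp
  let q : ℕ → V := fun n => pr1 (pt n)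
  have step : ∀ j, pt (2 * j) = Sum.inl (q (2 * j)) →
      ∃ z : V × V × Bool, pt (2 * j + 1) = Sum.inr z ∧
        pt (2 * j + 2) = Sum.inl (q (2 * j + 2)) ∧
        A.Edge (q (2 * j)) z.1 ∧ A.Edge z.1 (q (2 * j + 2)) := by
    intro j hj
    have h1 := hplay.2 (2 * j)
    have h2 := hplay.2 (2 * j + 1)
    rw [hj] at h1
    rcases hz : pt (2 * j + 1) with a | z
    · rw [hz] at h1; exact h1.elim
    · rw [hz] at h1 h2
      rcases hy : pt (2 * j + 2) with y | y
      · rw [show 2 * j + 1 + 1 = 2 * j + 2 from rfl, hy] at h2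
        have : q (2 * j + 2) = y := by simp [q, hy, pr1]
        rw [this]
        exact ⟨z, rfl, rfl, h1.1, h2⟩
      · rw [show 2 * j + 1 + 1 = 2 * j + 2 from rfl, hy] at h2
        exact h2.elim
  have heven : ∀ j, pt (2 * j) = Sum.inl (q (2 * j)) := by
    intro j
    induction j with
    | zero =>
      have := hplay.1
      simp [q, this, pr1]
    | succ j ih =>
      obtain ⟨z, -, h, -⟩ := step j ih
      exact h
  choose zs hz1 hz2 hz3 hz4 using fun j => step j (heven j)
  have hqodd : ∀ j, q (2 * j + 1) = (zs j).1 := by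
    intro j; simp [q, hz1, pr1]
  have hqplay : IsPlay A v0 q := by
    refine ⟨by simp [q, hplay.1, pr1], ?_⟩
    intro i
    rcases Nat.even_or_odd' i with ⟨j, rfl | rfl⟩
    · rw [hqodd]; exact hz3 j
    · rw [hqodd]; exact hz4 j
  have hpar := fun j => owner_parity hv0 hturn hqplay j
  have hmap : ∀ i, (histUpTo pt i).map pr1 = histUpTo q i := fun i => histUpTo_map _ _ _
  have hzs : ∀ j, ∃ l, l ++ [q (2 * j)] = histUpTo q (2 * j) ∧
      zs j = Z (cnt (histUpTo pt (2 * j))) l (q (2 * j)) := by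
    intro j
    obtain ⟨l, hl⟩ := histUpTo_snoc pt (2 * j)
    rw [heven] at hl
    refine ⟨l.map pr1, ?_, ?_⟩
    · rw [← hmap, hl]; simp [pr1]
    · have h := hresp (2 * j) (by rw [heven]; rfl)
      rw [hl, hφt, hz1, ← hl] at h
      exact Sum.inr.inj h
  have hfacts : ∀ j, (zs j).1 = φE (histUpTo q (2 * j)) ∧
        ((zs j).2.2 = true ↔
          ∀ b ∈ f (cnt (histUpTo pt (2 * j))), ¬ BPrefix b (histUpTo q (2 * j))) ∧
        ∀ k, reach (cnt (histUpTo pt (2 * j))) (histUpTo q (2 * j)) k →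
          ∃ p ∈ P, BPrefix p (histUpTo q (2 * j)) ∧
          p (2 * j + 2) = (zs j).2.1 ∧
          ∀ b ∈ f (cnt (histUpTo pt (2 * j))), ¬ ∀ i < 2 * j + 1 + k, b i = p i := by
    intro j
    obtain ⟨l, hl, hz⟩ := hzs j
    have := hZ3 (cnt (histUpTo pt (2 * j))) l (q (2 * j)) (hpar j).1
    rw [← hz, hl, histUpTo_length] at this
    exact this
  have hqresp : Respects A Player.E φE q := by
    intro i hi
    rcases Nat.even_or_odd' i with ⟨j, rfl | rfl⟩
    · rw [hqodd]; exact (hfacts j).1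
    · rw [(hpar j).2] at hi; cases hi
  have hqP : q ∈ P := ⟨hqplay, hqresp, fun i hi => absurd hi (hNoA _)⟩
  have hcnt : ∀ j, cnt (histUpTo pt (2 * (j + 1))) =
      cnt (histUpTo pt (2 * j)) + (zs j).2.2.toNat := by
    intro j
    rw [Nat.mul_succ, histUpTo_succ', histUpTo_succ', hz2, hz1]
    rcases hb : (zs j).2.2 <;> simp [cnt, List.countP_append, List.countP_cons, prb, hb]
  have hcT : ∀ j, (zs j).2.2 = true → cnt (histUpTo pt (2 * (j + 1))) =
      cnt (histUpTo pt (2 * j)) + 1 := by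
    intro j h; rw [hcnt, h]; rfl
  have hcF : ∀ j, (zs j).2.2 ≠ true → cnt (histUpTo pt (2 * (j + 1))) =
      cnt (histUpTo pt (2 * j)) := by
    intro j h; rw [hcnt, (by simpa using h : (zs j).2.2 = false)]; rfl
  refine ⟨fun n => q (2 * n), fun n => (zs n).1, fun n => (zs n).2.1, fun n => (zs n).2.2,
    heven, hz1, ?_⟩
  have hint : interleave (fun n => q (2 * n)) (fun n => (zs n).1) = q := by
    funext m
    rcases Nat.even_or_odd' m with ⟨j, rfl | rfl⟩
    · simp [interleave]
    · have h1 : (2 * j + 1) % 2 = 1 := by omega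
      have h2 : (2 * j + 1) / 2 = j := by omega
      simp [interleave, h1, h2, hqodd]
  rw [hint]
  by_cases hinf : {j | (zs j).2.2 = true}.Infinite
  · left
    refine ⟨?_, hinf⟩
    by_contra hq
    obtain ⟨n, hn⟩ := Set.mem_iUnion.1 (hcov ⟨hqP, hq⟩)
    -- some j with count n and top
    have hex : ∀ n, ∃ j, cnt (histUpTo pt (2 * j)) = n := by
      intro n
      induction n with
      | zero =>
        refine ⟨0, ?_⟩
        rw [Nat.mul_zero, histUpTo_zero', hplay.1]
        simp [cnt, prb]
      | succ n ih =>
        obtain ⟨j, hj⟩ := ih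
        by_contra hno
        push Not at hno
        have hc : ∀ i, cnt (histUpTo pt (2 * (j + i))) = n ∧ (zs (j + i)).2.2 ≠ true := by
          intro i
          induction i with
          | zero =>
            refine ⟨hj, fun h => hno (j + 1) ?_⟩
            rw [hcT j h, hj]
          | succ i ih =>
            have h1 : cnt (histUpTo pt (2 * (j + (i + 1)))) = n := by
              rw [← Nat.add_assoc, hcF _ ih.2, ih.1]
            refine ⟨h1, fun h => hno (j + (i + 1) + 1) ?_⟩
            rw [hcT _ h, h1]
        obtain ⟨i, hi, hij⟩ := hinf.exists_gt j
        have := (hc (i - j)).2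
        rw [show j + (i - j) = i by omega] at this
        exact this hi
    obtain ⟨j, hj⟩ := hex (n + 1)
    have hex2 : ∃ j, cnt (histUpTo pt (2 * j)) = n ∧ (zs j).2.2 = true := by
      by_contra hno
      push Not at hno
      have hle : ∀ j, cnt (histUpTo pt (2 * j)) ≤ n := by
        intro j
        induction j with
        | zero =>
          rw [Nat.mul_zero, histUpTo_zero', hplay.1]
          simp [cnt, prb]
        | succ j ih =>
          by_cases h : (zs j).2.2 = true
          · have : cnt (histUpTo pt (2 * j)) ≠ n := fun h' => hno j h' h
            rw [hcT j h]
            omega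
          · rw [hcF j h]
            exact ih
      have := hle j
      omega
    obtain ⟨j, hj, hjt⟩ := hex2
    have := (hfacts j).2.1.1 hjt q (by rw [hj]; exact hn)
    exact this ((bprefix_hist _ _ _).2 (fun _ _ => rfl))
  · right
    have hfin := Set.not_infinite.1 hinf
    refine ⟨hfin, ?_⟩
    intro hfin2
    obtain ⟨N1, hN1⟩ := hfin.bddAbove
    obtain ⟨N2, hN2⟩ := hfin2.bddAbove
    let J := N1 + N2 + 1
    have hb : ∀ j, J ≤ j → (zs j).2.2 ≠ true := by
      intro j hj h
      have := hN1 h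
      omega
    have hw : ∀ j, J ≤ j → q (2 * j + 2) = (zs j).2.1 := by
      intro j hj
      by_contra h
      have : j ≤ N2 := hN2 h
      omega
    let n := cnt (histUpTo pt (2 * J))
    have hc : ∀ i, cnt (histUpTo pt (2 * (J + i))) = n := by
      intro i
      induction i with
      | zero => rfl
      | succ i ih => rw [← Nat.add_assoc, hcF _ (hb _ (by omega)), ih]
    obtain ⟨v, ⟨p, hpP, hpv⟩, huv, hv⟩ := hf n (histUpTo q (2 * J))
      ⟨q, hqP, (bprefix_hist _ _ _).2 (fun _ _ => rfl)⟩
    have hred : ∀ k i, ¬ reach n (histUpTo q (2 * (J + i))) k := by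
      intro k
      induction k using Nat.strong_induction_on with
      | _ k ih =>
        intro i hr
        have hfa := hfacts (J + i)
        rw [hc i] at hfa
        have hnt := fun h => hb (J + i) (by omega) (hfa.2.1.2 h)
        obtain ⟨p, hp, hpu, hpw, hpk⟩ := hfa.2.2 k hr
        rw [bprefix_hist] at hpu
        have hpodd : p (2 * (J + i) + 1) = q (2 * (J + i) + 1) := by
          have ho : A.owner (p (2 * (J + i))) = Player.E := by
            rw [hpu _ le_rfl]; exact (hpar _).1
          rw [hp.2.1 _ ho, hqresp _ (hpar _).1, histUpTo_congr hpu]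
        have hpe : p (2 * (J + i) + 2) = q (2 * (J + i) + 2) := by
          rw [hpw, hw _ (by omega)]
        by_cases hk : k = 0
        · apply hnt
          intro b hb' hbq
          rw [bprefix_hist] at hbq
          apply hpk b hb'
          intro i' hi'
          rw [hbq i' (by omega), hpu i' (by omega)]
        · refine ih (k - 2) (by omega) (i + 1) ⟨p, hp, ?_, ?_⟩
          · rw [bprefix_hist]
            intro i' hi'
            rcases (by omega : i' ≤ 2 * (J + i) ∨ i' = 2 * (J + i) + 1 ∨ i' = 2 * (J + i) + 2)
              with h | h | h
            · exact hpu _ h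
            · rw [h, hpodd]
            · rw [h, hpe]
          · intro b hb' hbk
            rw [histUpTo_length] at hbk
            exact hpk b hb' (fun i' hi' => hbk i' (by omega))
    refine hred v.length 0 ⟨p, hpP, ?_, ?_⟩
    · intro i
      obtain ⟨t, ht⟩ := huv
      subst ht
      have := hpv ⟨i.1, by simp; omega⟩
      rw [this]
      simp
    · intro b hb' hbk
      apply hv b hb'
      intro i
      rw [hbk i.1 (by omega)]
      exact hpv i

/-- In a turn-based Éloïse–Nature game (Abélard owns no vertex)
with a Borel winning condition, Éloïse has a topologically-good strategy iff she
has a winning strategy in the associated two-player game `G̃`; moreover from a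
winning (resp. positional, resp. finite-memory) strategy of Éloïse in `G̃` one can
define a topologically-good (resp. positional, resp. finite-memory) strategy for
her in `G`. -/
theorem stmt7 {V : Type} [Countable V] (A : Arena V) (v0 : V)
    (Ω : Set (ℕ → V)) (hΩ : BorelWC Ω)
    (hNoA : ∀ v, A.owner v ≠ Player.A) (hv0 : A.owner v0 = Player.E)
    (hturn : ∀ v w, A.Edge v w →
      (A.owner v = Player.E ∧ A.owner w = Player.N) ∨
      (A.owner v = Player.N ∧ A.owner w = Player.E)) :
    ((∃ φE, IsStrategyFor A Player.E φE ∧ TopGood A v0 Ω φE) ↔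
      ∃ φt, IsStrategyFor (tildeArena A) Player.E φt ∧
        WinsE (tildeArena A) (Sum.inl v0) (tildeWC Ω) φt) ∧
    (∀ φt, IsStrategyFor (tildeArena A) Player.E φt →
      WinsE (tildeArena A) (Sum.inl v0) (tildeWC Ω) φt →
      ∃ φE, IsStrategyFor A Player.E φE ∧ TopGood A v0 Ω φE ∧
        (PositionalF φt → PositionalF φE) ∧
        (FiniteMemoryF φt → FiniteMemoryF φE)) := by
  have hback : ∀ φt, IsStrategyFor (tildeArena A) Player.E φt →
      WinsE (tildeArena A) (Sum.inl v0) (tildeWC Ω) φt →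
      ∃ φE, IsStrategyFor A Player.E φE ∧ TopGood A v0 Ω φE ∧
        (PositionalF φt → PositionalF φE) ∧
        (FiniteMemoryF φt → FiniteMemoryF φE) := fun φt hs hw =>
    ⟨phiE A v0 φt, phiE_strat v0 hs, back_topgood hNoA hv0 hturn hs hw,
      phiE_pos v0, phiE_fin v0⟩
  refine ⟨⟨?_, ?_⟩, hback⟩
  · rintro ⟨φE, hs, hg⟩
    exact forward hNoA hv0 hturn hs hg
  · rintro ⟨φt, hs, hw⟩
    obtain ⟨φE, h1, h2, -⟩ := hback φt hs hw
    exact ⟨φE, h1, h2⟩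
end
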